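/- arXiv:2306.07482 — 7 statements merged into one kernel-verified Lean document; each statement's English description precedes it below -/
import Mathlib

section
/- Assume β^v_i < 1 < α^v_i/γ^v_i for all i = 1,…,ℓ and fix N ≥ 1. Suppose that for j = 0,…,kN−1 and i = 1,…,ℓ there are vectors α⃗_{j,i}, β⃗_{j,i}, γ⃗_{j,i} ∈ ℝ_{>0}^k whose coordinatewise products a_{j,i} := ∏_m (α⃗_{j,i})_m, b_{j,i} := ∏_m (β⃗_{j,i})_m, c_{j,i} := ∏_m (γ⃗_{j,i})_m satisfy b_{j,i} < 1 < a_{j,i}/c_{j,i}. Set (Φ_j)_+(z) := φ^b(z;α⃗_{j,ℓ},γ⃗_{j,ℓ})⋯φ^b(z;α⃗_{j,1},γ⃗_{j,1}) and (Φ_j)_−(z) := φ^g(z;β⃗_{j,1})⋯φ^g(z;β⃗_{j,ℓ}), and assume that the sequence Φ_0 := Φ, Φ_{j+1} := (Φ_j)_+ (Φ_j)_− satisfies Φ_j = (Φ_j)_− (Φ_j)_+ for every j = 0,…,kN−1, wherever both sides are defined. Suppose φ̃_+, φ̃_− are matrix functions such that φ̃_+ and its pointwise inverse are analytic on an open set containing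 the closed unit disc, φ̃_− and its pointwise inverse are analytic on an open set containing {z : |z| ≥ 1} with z^{ℓN} φ̃_−(z) → I as z → ∞, and Φ(z)^{kN} = φ̃_−(z) φ̃_+(z) for |z| = 1. Then: (1) the limit C := lim_{z→∞} (Φ_0)_−(z)(Φ_1)_−(z)⋯(Φ_{kN−1})_−(z) exists and is an invertible matrix; and (2) for every z with |z| = 1, every w ∈ ℂ with det(Φ(z)−wI) = 0, every column vector ψ_{0,+} with (Φ(z)−wI)ψ_{0,+} = 0 and every row vector ψ_{0,−} with ψ_{0,−}(Φ(z)−wI) = 0, defining recursively ψ_{j+1,+} := (Φ_j)_+(z) ψ_{j,+} and ψ_{j+1,−} := ψ_{j,−} (Φ_j)_−(z), one has z^{ℓN} C ψ_{kN,+} = φ̃_+(z) ψ_{0,+} and ψ_{kN,−} z^{−ℓN} C^{−1} = ψ_{0,−} φ̃_−(z). -/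
open scoped BigOperators

/-- The matrix `φ^b(z;α,γ)`: `diag(γ) + Σ_{i=1}^{k−1} α_i E_{i+1,i} + α_k z⁻¹ E_{1,k}`
(indices here are 0-based). -/
noncomputable def phiB (k : ℕ) (z : ℂ) (α γ : Fin k → ℂ) : Matrix (Fin k) (Fin k) ℂ :=
  Matrix.of fun (i j : Fin k) =>
    (if i = j then γ i else 0) + (if (i : ℕ) = (j : ℕ) + 1 then α j else 0) +
      (if (i : ℕ) = 0 ∧ (j : ℕ) = k - 1 then α j * z⁻¹ else 0)

/-- Value of a `Fin k`-indexed vector at a natural number (1 outside range). -/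
noncomputable def bval {k : ℕ} (β : Fin k → ℂ) (m : ℕ) : ℂ :=
  if h : m < k then β ⟨m, h⟩ else 1

/-- The matrix `φ^g(z;β) = (1 − β z⁻¹)⁻¹ G(z;β)` with
`G_{ij} = β_j⋯β_{i−1}` for `i ≥ j` and `G_{ij} = z⁻¹ (β_j⋯β_k)(β_1⋯β_{i−1})` for `i < j`
(0-based indices). -/
noncomputable def phiG (k : ℕ) (z : ℂ) (β : Fin k → ℂ) : Matrix (Fin k) (Fin k) ℂ :=
  (1 - (∏ i, β i) * z⁻¹)⁻¹ •
    Matrix.of fun (i j : Fin k) =>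
      if (j : ℕ) ≤ (i : ℕ) then ∏ m ∈ Finset.Ico (j : ℕ) (i : ℕ), bval β m
      else z⁻¹ * (∏ m ∈ Finset.Ico (j : ℕ) k, bval β m) * ∏ m ∈ Finset.Ico 0 (i : ℕ), bval β m


/-- The sequence `φ_1, φ_2, φ_3, …` (0-based: `phiSeq m = φ_{m+1}`), extended
`2ℓ`-periodically: odd-indexed are `φ^b`'s and even-indexed are `φ^g`'s. -/
noncomputable def phiSeq (k ℓ : ℕ) [NeZero ℓ] (α β γ : Fin k → Fin ℓ → ℝ) (z : ℂ) (m : ℕ) :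
    Matrix (Fin k) (Fin k) ℂ :=
  let i : Fin ℓ := ⟨(m / 2) % ℓ, Nat.mod_lt _ (Nat.pos_of_neZero ℓ)⟩
  if m % 2 = 0 then phiB k z (fun j => (α j i : ℂ)) (fun j => (γ j i : ℂ))
  else phiG k z (fun j => (β j i : ℂ))

/-- `prodPhiRange … s t = φ_{s+1} φ_{s+2} ⋯ φ_t`, the ordered product of the `φ_m` for
`m ∈ (s, t]` (1-based); in particular `prodPhiRange … 0 n = φ_1⋯φ_n` and
`prodPhiRange … 0 (2ℓ) = Φ`. -/
noncomputable def prodPhiRange (k ℓ : ℕ) [NeZero ℓ] (α β γ : Fin k → Fin ℓ → ℝ) (z : ℂ)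
    (s t : ℕ) : Matrix (Fin k) (Fin k) ℂ :=
  ((List.range (t - s)).map fun u => phiSeq k ℓ α β γ z (s + u)).prod


/-- `(Φ_j)_+(z) = φ^b(z;α⃗_{j,ℓ},γ⃗_{j,ℓ})⋯φ^b(z;α⃗_{j,1},γ⃗_{j,1})` (reversed order). -/
noncomputable def Pplus (k ℓ : ℕ) (A C : ℕ → Fin ℓ → Fin k → ℝ) (j : ℕ) (z : ℂ) :
    Matrix (Fin k) (Fin k) ℂ :=
  (List.ofFn fun i : Fin ℓ =>
    phiB k z (fun m => (A j i.rev m : ℂ)) (fun m => (C j i.rev m : ℂ))).prod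

/-- `(Φ_j)_−(z) = φ^g(z;β⃗_{j,1})⋯φ^g(z;β⃗_{j,ℓ})`. -/
noncomputable def Pminus (k ℓ : ℕ) (B : ℕ → Fin ℓ → Fin k → ℝ) (j : ℕ) (z : ℂ) :
    Matrix (Fin k) (Fin k) ℂ :=
  (List.ofFn fun i : Fin ℓ => phiG k z (fun m => (B j i m : ℂ))).prod

open Filter Topology

section MatrixFunctions

open Polynomial

variable {k : ℕ}

theorem phiB_mul_zero_row (z : ℂ) (α γ : Fin (k + 1) → ℂ)
    (X : Matrix (Fin (k + 1)) (Fin (k + 1)) ℂ) (j : Fin (k + 1)) :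
    (phiB (k + 1) z α γ * X) 0 j
      = γ 0 * X 0 j + α (Fin.last k) * z⁻¹ * X (Fin.last k) j := by
  have h : ∀ m : Fin (k + 1), phiB (k + 1) z α γ 0 m
      = (if m = 0 then γ 0 else 0) + (if m = Fin.last k then α (Fin.last k) * z⁻¹ else 0) := by
    intro m
    simp only [phiB, Matrix.of_apply]
    congr 1
    · simp [eq_comm]
    · by_cases hm : m = Fin.last k
      · simp [hm]
      · have : (m : ℕ) ≠ k := fun h => hm (Fin.ext (by simpa using h))
        simp [hm, this]
  simp [Matrix.mul_apply, h, add_mul, Finset.sum_add_distrib]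

theorem phiB_mul_succ_row (z : ℂ) (α γ : Fin (k + 1) → ℂ)
    (X : Matrix (Fin (k + 1)) (Fin (k + 1)) ℂ) (i : Fin k) (j : Fin (k + 1)) :
    (phiB (k + 1) z α γ * X) i.succ j
      = γ i.succ * X i.succ j + α i.castSucc * X i.castSucc j := by
  have h : ∀ m : Fin (k + 1), phiB (k + 1) z α γ i.succ m
      = (if m = i.succ then γ i.succ else 0)
        + (if m = i.castSucc then α i.castSucc else 0) := by
    intro m
    by_cases hm : m = i.castSucc
    · simp [phiB, hm, eq_comm]
    · have : (i : ℕ) ≠ m := fun h => hm (Fin.ext (by simp [h]))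
      simp [phiB, hm, this, eq_comm]
  simp [Matrix.mul_apply, h, add_mul, Finset.sum_add_distrib]

theorem phiB_neg_one_mul_phiG (z : ℂ) (β : Fin k → ℂ) (hz : 1 - (∏ i, β i) * z⁻¹ ≠ 0) :
    phiB k z (fun i => -β i) (fun _ => 1) * phiG k z β = 1 := by
  obtain _ | k := k
  · exact Subsingleton.elim _ _
  have hb : ∀ i : Fin (k + 1), bval β i = β i := fun i => dif_pos i.isLt
  have hall : ∏ i, β i = ∏ m ∈ Finset.Ico 0 (k + 1), bval β m := by
    rw [← Finset.range_eq_Ico, Finset.prod_range]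
    simp [hb]
  have hsplit : ∀ a b, a ≤ b → ∏ m ∈ Finset.Ico a (b + 1), bval β m
      = (∏ m ∈ Finset.Ico a b, bval β m) * bval β b :=
    fun a b hab => Finset.prod_Ico_succ_top hab _
  rw [phiG, Matrix.mul_smul]
  ext i j
  rw [Matrix.smul_apply, smul_eq_mul, inv_mul_eq_iff_eq_mul₀ hz]
  obtain rfl | ⟨i, rfl⟩ := i.eq_zero_or_eq_succ
  · have hlast : β (Fin.last k) = bval β k := by simpa using (hb (Fin.last k)).symm
    rw [phiB_mul_zero_row, hlast]
    have hj : (j : ℕ) ≤ k := by omega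
    by_cases h0 : j = 0
    · subst h0
      simp only [Matrix.of_apply, hall, hsplit 0 k (Nat.zero_le k)]
      simp
      ring
    · have h0' : (j : ℕ) ≠ 0 := fun h => h0 (Fin.ext h)
      simp only [Matrix.of_apply, hsplit j k hj, Matrix.one_apply_ne' h0]
      simp [h0', hj]
      ring
  · have hi : β i.castSucc = bval β i := by simpa using (hb i.castSucc).symm
    rw [phiB_mul_succ_row, hi]
    simp only [Matrix.of_apply, Fin.val_succ, Fin.val_castSucc]
    rcases lt_trichotomy (j : ℕ) (i + 1) with h | h | h
    · have h1 : (j : ℕ) ≤ i := by omega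
      have hne : i.succ ≠ j := fun e => by
        have := congrArg Fin.val e
        simp at this
        omega
      rw [if_pos h.le, if_pos h1, hsplit _ _ h1, Matrix.one_apply_ne hne]
      ring
    · have he : i.succ = j := Fin.ext (by simp [h])
      rw [if_pos h.le, if_neg (by omega), he, Matrix.one_apply_eq, h, hall,
        ← Finset.prod_Ico_consecutive _ (Nat.zero_le (i + 1 : ℕ)) (by omega : (i + 1 : ℕ) ≤ k + 1),
        hsplit 0 i (Nat.zero_le _)]
      simp
      ring
    · have hne : i.succ ≠ j := fun e => by
        have := congrArg Fin.val e
        simp at this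
        omega
      rw [if_neg (by omega), if_neg (by omega), hsplit 0 i (Nat.zero_le _),
        Matrix.one_apply_ne hne]
      ring

theorem phiB_eq_diagonal_mul (z : ℂ) (α γ : Fin k → ℂ) (hγ : ∀ i, γ i ≠ 0) :
    phiB k z α γ
      = Matrix.diagonal γ * phiB k z (fun i => α i / γ (finRotate k i)) (fun _ => 1) := by
  obtain _ | k := k
  · exact Subsingleton.elim _ _
  ext i j
  have h1 : (i : ℕ) = (j : ℕ) + 1 → γ i * (α j / γ (finRotate (k + 1) j)) = α j := by
    intro h
    have : finRotate (k + 1) j = i := by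
      apply Fin.ext
      rw [coe_finRotate_of_ne_last, h]
      rintro rfl
      simp at h
      omega
    rw [this, mul_div_cancel₀ _ (hγ i)]
  have h2 : (i : ℕ) = 0 ∧ (j : ℕ) = k + 1 - 1 →
      γ i * (α j / γ (finRotate (k + 1) j) * z⁻¹) = α j * z⁻¹ := by
    rintro ⟨hi, hj⟩
    have : finRotate (k + 1) j = i := by
      have hj' : j = Fin.last k := Fin.ext (by simpa using hj)
      rw [hj', finRotate_last]
      exact Fin.ext hi.symm
    rw [← mul_assoc, this, mul_div_cancel₀ _ (hγ i)]
  rw [Matrix.diagonal_mul]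
  simp only [phiB, Matrix.of_apply, mul_add, mul_ite, mul_zero, mul_one]
  congr 1
  · congr 1
    exact ite_congr rfl (fun h => (h1 h).symm) fun _ => rfl
  · exact ite_congr rfl (fun h => (h2 h).symm) fun _ => rfl

theorem isUnit_phiB (z : ℂ) (α γ : Fin k → ℂ) (hγ : ∀ i, γ i ≠ 0)
    (h : ‖∏ i, α i‖ ≠ ‖∏ i, γ i‖ * ‖z‖) : IsUnit (phiB k z α γ) := by
  set δ : Fin k → ℂ := fun i => -(α i / γ (finRotate k i)) with hδ
  have hnorm : ‖∏ i, δ i‖ * ‖∏ i, γ i‖ = ‖∏ i, α i‖ := by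
    simp only [hδ, norm_prod, norm_neg, norm_div, Finset.prod_div_distrib]
    rw [Equiv.prod_comp (finRotate k) fun i => ‖γ i‖]
    exact div_mul_cancel₀ _ (Finset.prod_ne_zero_iff.2 fun i _ => norm_ne_zero_iff.2 (hγ i))
  have hz : 1 - (∏ i, δ i) * z⁻¹ ≠ 0 := by
    intro h0
    have hz0 : z ≠ 0 := by
      rintro rfl
      simp at h0
    have : ∏ i, δ i = z := by
      rw [← div_eq_mul_inv] at h0
      exact (div_eq_one_iff_eq hz0).1 (sub_eq_zero.1 h0).symm
    exact h (by rw [← hnorm, this, mul_comm])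
  have hdiag : IsUnit (Matrix.diagonal γ) := by
    rw [Matrix.isUnit_diagonal, Pi.isUnit_iff]
    exact fun i => (hγ i).isUnit
  rw [phiB_eq_diagonal_mul z α γ hγ]
  refine hdiag.mul ?_
  have := phiB_neg_one_mul_phiG z δ hz
  simp only [hδ, neg_neg] at this
  exact IsUnit.of_mul_eq_one _ this

/-- `M` is a matrix-valued function of `z` whose entries are polynomials in `z⁻¹`, with the
power of `z⁻¹` in entry `(i, j)` bounded as for a path with at most `s` steps down from `i` to `j`
around a cycle of length `k`, each full turn contributing one factor `z⁻¹`. -/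
def HasWinding (s : ℕ) (M : ℂ → Matrix (Fin k) (Fin k) ℂ) : Prop :=
  ∃ p : Matrix (Fin k) (Fin k) ℂ[X],
    (∀ z, M z = p.map (evalRingHom z⁻¹)) ∧
    ∀ i j n, (p i j).coeff n ≠ 0 → k * n + i ≤ s + j

theorem HasWinding.one : HasWinding 0 (fun _ => (1 : Matrix (Fin k) (Fin k) ℂ)) := by
  refine ⟨1, fun z => by rw [Matrix.map_one] <;> simp, fun i j n h => ?_⟩
  by_cases hij : i = j
  · subst hij
    rw [Matrix.one_apply_eq, coeff_one] at h
    have : n = 0 := by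
      by_contra hn
      exact h (if_neg hn)
    simp [this]
  · simp [Matrix.one_apply_ne hij] at h

theorem HasWinding.mul {s t : ℕ} {M N : ℂ → Matrix (Fin k) (Fin k) ℂ}
    (hM : HasWinding s M) (hN : HasWinding t N) : HasWinding (s + t) (fun z => M z * N z) := by
  obtain ⟨p, hp, hp'⟩ := hM
  obtain ⟨q, hq, hq'⟩ := hN
  refine ⟨p * q, fun z => by simp only [Matrix.map_mul, hp, hq], fun i j n h => ?_⟩
  rw [Matrix.mul_apply, finsetSum_coeff] at h
  obtain ⟨l, -, hl⟩ := Finset.exists_ne_zero_of_sum_ne_zero h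
  rw [coeff_mul] at hl
  obtain ⟨⟨a, b⟩, hab, hl⟩ := Finset.exists_ne_zero_of_sum_ne_zero hl
  have h1 := hp' i l a (left_ne_zero_of_mul hl)
  have h2 := hq' l j b (right_ne_zero_of_mul hl)
  rw [← Finset.HasAntidiagonal.mem_antidiagonal.1 hab, mul_add]
  dsimp only at h1 h2 ⊢
  omega

theorem HasWinding.list_prod {ι : Type*} (f : ι → ℂ → Matrix (Fin k) (Fin k) ℂ) {s : ℕ}
    (hf : ∀ i, HasWinding s (f i)) (l : List ι) :
    HasWinding (s * l.length) (fun z => (l.map fun i => f i z).prod) := by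
  induction l with
  | nil => exact .one
  | cons a l ih =>
    simp only [List.map_cons, List.prod_cons, List.length_cons, mul_add_one, add_comm (s * _)]
    exact (hf a).mul ih

theorem HasWinding.phiB (α γ : Fin k → ℂ) : HasWinding 1 (fun z => phiB k z α γ) := by
  refine ⟨Matrix.of fun i j => (if i = j then C (γ i) else 0) +
    (if (i : ℕ) = (j : ℕ) + 1 then C (α j) else 0) +
      (if (i : ℕ) = 0 ∧ (j : ℕ) = k - 1 then C (α j) * X else 0), fun z => ?_, fun i j n h => ?_⟩
  · ext i j
    simp [_root_.phiB, apply_ite (eval z⁻¹)]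
  · contrapose! h
    have hn : n ≠ 0 → ∀ a : ℂ, (C a).coeff n = 0 := fun hn a => coeff_C_of_ne_zero hn
    have hn' : n ≠ 1 → ∀ a : ℂ, (C a * X).coeff n = 0 := fun hn a => by
      rw [coeff_C_mul, coeff_X_of_ne_one hn, mul_zero]
    have hi := i.isLt
    simp only [Matrix.of_apply, coeff_add]
    have h1 : (if i = j then C (γ i) else 0).coeff n = 0 := by
      split_ifs with hij
      · exact hn (by rintro rfl; subst hij; omega) _
      · simp
    have h2 : (if (i : ℕ) = (j : ℕ) + 1 then C (α j) else 0).coeff n = 0 := by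
      split_ifs with hij
      · exact hn (by rintro rfl; omega) _
      · simp
    have h3 : (if (i : ℕ) = 0 ∧ (j : ℕ) = k - 1 then C (α j) * X else 0).coeff n = 0 := by
      split_ifs with hij
      · exact hn' (by rintro rfl; omega) _
      · simp
    rw [h1, h2, h3]
    simp

theorem HasWinding.exists_polynomial {n : ℕ} {M : ℂ → Matrix (Fin k) (Fin k) ℂ}
    (hM : HasWinding (k * n) M) :
    ∃ Q : Matrix (Fin k) (Fin k) ℂ[X], ∀ z, z ≠ 0 → Q.map (eval z) = z ^ n • M z := by
  obtain ⟨p, hp, hp'⟩ := hM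
  refine ⟨p.map (reflect n), fun z hz => ?_⟩
  ext i j
  have hdeg : (p i j).natDegree ≤ n := by
    refine natDegree_le_iff_coeff_eq_zero.2 fun m hm => ?_
    by_contra h
    have h1 := hp' i j m h
    have h2 : k * (n + 1) ≤ k * m := Nat.mul_le_mul_left k hm
    rw [mul_add_one] at h2
    have := j.isLt
    omega
  let := invertibleOfNonzero (inv_ne_zero hz)
  have h := eval₂_reflect_mul_pow (RingHom.id ℂ) z⁻¹ n (p i j) hdeg
  rw [invOf_eq_inv, inv_inv, inv_pow] at h
  have hzn : z ^ n ≠ 0 := pow_ne_zero n hz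
  rw [hp, Matrix.smul_apply, Matrix.map_apply, Matrix.map_apply, Matrix.map_apply,
    coe_evalRingHom, smul_eq_mul, ← eval₂_id (x := z⁻¹), ← h, eval₂_id]
  field_simp

theorem tendsto_matrix_iff {ι : Type*} {l : Filter ι} {M : ι → Matrix (Fin k) (Fin k) ℂ}
    {L : Matrix (Fin k) (Fin k) ℂ} :
    Tendsto M l (𝓝 L) ↔ ∀ i j, Tendsto (fun x => M x i j) l (𝓝 (L i j)) :=
  tendsto_pi_nhds.trans (forall_congr' fun _ => tendsto_pi_nhds)

/-- `M` is invertible outside the open unit disc with analytic inverse there, and both `M` and its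
inverse converge at infinity. -/
def IsExteriorUnit (M : ℂ → Matrix (Fin k) (Fin k) ℂ) : Prop :=
  ∃ (N : ℂ → Matrix (Fin k) (Fin k) ℂ) (L L' : Matrix (Fin k) (Fin k) ℂ),
    (∀ z, 1 ≤ ‖z‖ → N z * M z = 1) ∧
    (∀ z, 1 ≤ ‖z‖ → ∀ i j, AnalyticAt ℂ (fun z => N z i j) z) ∧
    Tendsto M (Bornology.cobounded ℂ) (𝓝 L) ∧ Tendsto N (Bornology.cobounded ℂ) (𝓝 L')

theorem analyticAt_matrix_mul {M N : ℂ → Matrix (Fin k) (Fin k) ℂ} {z : ℂ}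
    (hM : ∀ i j, AnalyticAt ℂ (fun z => M z i j) z)
    (hN : ∀ i j, AnalyticAt ℂ (fun z => N z i j) z) (i j : Fin k) :
    AnalyticAt ℂ (fun z => (M z * N z) i j) z := by
  simp only [Matrix.mul_apply]
  exact Finset.analyticAt_fun_sum _ fun l _ => (hM i l).mul (hN l j)

theorem IsExteriorUnit.one : IsExteriorUnit (fun _ => (1 : Matrix (Fin k) (Fin k) ℂ)) :=
  ⟨fun _ => 1, 1, 1, fun _ _ => one_mul 1, fun _ _ _ _ => analyticAt_const, tendsto_const_nhds,
    tendsto_const_nhds⟩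

theorem IsExteriorUnit.mul {M M' : ℂ → Matrix (Fin k) (Fin k) ℂ}
    (hM : IsExteriorUnit M) (hM' : IsExteriorUnit M') :
    IsExteriorUnit (fun z => M z * M' z) := by
  obtain ⟨N, L, K, h1, h2, h3, h4⟩ := hM
  obtain ⟨N', L', K', h1', h2', h3', h4'⟩ := hM'
  refine ⟨fun z => N' z * N z, L * L', K' * K, fun z hz => ?_, fun z hz => ?_, h3.mul h3',
    h4'.mul h4⟩
  · rw [mul_assoc, ← mul_assoc (N z), h1 z hz, one_mul, h1' z hz]
  · exact analyticAt_matrix_mul (h2' z hz) (h2 z hz)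

theorem IsExteriorUnit.list_prod {ι : Type*} (f : ι → ℂ → Matrix (Fin k) (Fin k) ℂ) (l : List ι)
    (hf : ∀ i ∈ l, IsExteriorUnit (f i)) :
    IsExteriorUnit (fun z => (l.map fun i => f i z).prod) := by
  induction l with
  | nil => exact .one
  | cons a l ih =>
    simp only [List.map_cons, List.prod_cons]
    exact (hf a (by simp)).mul (ih fun i hi => hf i (by simp [hi]))

theorem IsExteriorUnit.phiG (β : Fin k → ℂ) (hβ : ‖∏ i, β i‖ < 1) :
    IsExteriorUnit (fun z => phiG k z β) := by
  have hinv : Tendsto (fun z : ℂ => z⁻¹) (Bornology.cobounded ℂ) (𝓝 0) :=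
    tendsto_inv₀_cobounded
  refine ⟨fun z => phiB k z (fun i => -β i) (fun _ => 1),
    Matrix.of fun i j => if (j : ℕ) ≤ (i : ℕ) then ∏ m ∈ Finset.Ico (j : ℕ) (i : ℕ), bval β m else 0,
    phiB k 0 (fun i => -β i) (fun _ => 1), fun z hz => ?_, fun z hz i j => ?_, ?_, ?_⟩
  · apply phiB_neg_one_mul_phiG
    rw [sub_ne_zero]
    intro h
    have hz0 : 0 < ‖z‖ := by linarith
    have h' := congrArg norm h
    rw [norm_one, norm_mul, norm_inv, ← div_eq_mul_inv, eq_div_iff hz0.ne'] at h'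
    linarith
  · have hz0 : z ≠ 0 := norm_pos_iff.1 (by linarith)
    have : AnalyticAt ℂ (fun z : ℂ => z⁻¹) z := analyticAt_inv hz0
    simp only [phiB, Matrix.of_apply]
    split_ifs <;> fun_prop
  · have hs : Tendsto (fun z : ℂ => (1 - (∏ i, β i) * z⁻¹)⁻¹) (Bornology.cobounded ℂ) (𝓝 1) := by
      simpa using ((hinv.const_mul (∏ i, β i)).const_sub 1).inv₀ (by simp)
    refine tendsto_matrix_iff.2 fun i j => ?_
    simp only [_root_.phiG, Matrix.smul_apply, Matrix.of_apply, smul_eq_mul]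
    split_ifs
    · simpa using hs.mul_const _
    · simpa [mul_assoc] using hs.mul (hinv.mul_const _)
  · refine tendsto_matrix_iff.2 fun i j => ?_
    simp only [phiB, Matrix.of_apply, inv_zero]
    refine tendsto_const_nhds.add ?_
    split_ifs
    · exact hinv.const_mul _
    · exact tendsto_const_nhds

end MatrixFunctions

theorem eq_of_analyticAt_of_tendsto_cobounded {f g : ℂ → ℂ} {c : ℂ}
    (hf : ∀ z, ‖z‖ ≤ 1 → AnalyticAt ℂ f z) (hg : ∀ z, 1 ≤ ‖z‖ → AnalyticAt ℂ g z)
    (hc : Tendsto g (Bornology.cobounded ℂ) (𝓝 c)) (hfg : ∀ z, ‖z‖ = 1 → f z = g z)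
    {z : ℂ} (hz : ‖z‖ ≤ 1) : f z = c := by
  set F : ℂ → ℂ := fun z => if ‖z‖ ≤ 1 then f z else g z with hF
  have hdiff : Differentiable ℂ F := by
    intro w
    rcases lt_trichotomy ‖w‖ 1 with hw | hw | hw
    · refine (hf w hw.le).differentiableAt.congr_of_eventuallyEq ?_
      filter_upwards [continuous_norm.continuousAt.eventually_lt_const hw] with u hu
      exact if_pos hu.le
    · have hev : ∀ᶠ u in 𝓝 w, f u = g u := by
        rw [← (hf w hw.le).frequently_eq_iff_eventually_eq (hg w hw.ge)]
        have ht : Tendsto (fun t : ℝ => w * Complex.exp (t * Complex.I)) (𝓝[≠] 0) (𝓝[≠] w) := by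
          have hd : HasDerivAt (fun t : ℝ => w * Complex.exp (t * Complex.I))
              (w * (Complex.exp ((0 : ℝ) * Complex.I) * Complex.I)) 0 := by
            have := ((Complex.ofRealCLM.hasDerivAt (x := (0 : ℝ))).mul_const Complex.I).cexp
            simpa using this.const_mul w
          have hw0 : w ≠ 0 := norm_ne_zero_iff.1 (by simp [hw])
          simpa using hd.tendsto_nhdsNE (by simp [hw0])
        exact ht.frequently (Frequently.of_forall fun t => hfg _ (by
          rw [norm_mul, hw, Complex.norm_exp_ofReal_mul_I, one_mul]))
      refine (hf w hw.le).differentiableAt.congr_of_eventuallyEq ?_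
      filter_upwards [hev] with u hu
      simp [hF, hu]
    · refine (hg w hw.le).differentiableAt.congr_of_eventuallyEq ?_
      filter_upwards [continuous_norm.continuousAt.eventually_const_lt hw] with u hu
      exact if_neg hu.not_ge
  have hlim : Tendsto F (cocompact ℂ) (𝓝 c) := by
    rw [← Metric.cobounded_eq_cocompact]
    refine hc.congr' ?_
    filter_upwards [tendsto_norm_cobounded_atTop.eventually_gt_atTop 1] with u hu
    exact (if_neg hu.not_ge).symm
  exact (if_pos hz).symm.trans (hdiff.apply_eq_of_tendsto_cocompact z hlim)

/-- Iterating the exchange of factors `Φ j = M j * P j`, `Φ (j + 1) = P j * M j` turns a power of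
`Φ 0` into a product of `M`s times a product of `P`s. -/
theorem pow_eq_mul_of_exchange {R : Type*} [Monoid R] (Φ M P M' P' : ℕ → R) (n : ℕ)
    (hΦ : ∀ j < n, Φ j = M j * P j) (hΦ' : ∀ j, Φ (j + 1) = P j * M j)
    (hM0 : M' 0 = 1) (hM : ∀ j, M' (j + 1) = M' j * M j)
    (hP0 : P' 0 = 1) (hP : ∀ j, P' (j + 1) = P j * P' j) :
    ∀ j ≤ n, Φ 0 ^ j = M' j * P' j := by
  have hcomm : ∀ j ≤ n, M' j * Φ j = Φ 0 * M' j := by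
    intro j hj
    induction j with
    | zero => simp [hM0]
    | succ j ih =>
      rw [hM, hΦ', ← mul_assoc, mul_assoc (M' j), ← hΦ j hj, ih (by omega), mul_assoc]
  intro j hj
  induction j with
  | zero => simp [hM0, hP0]
  | succ j ih =>
    rw [pow_succ', ih (by omega), ← mul_assoc, ← hcomm j (by omega), hΦ j hj, hM, hP]
    simp only [mul_assoc]

/-- Theorem 5.1 (Wiener–Hopf factorization via the eigenvector flow):  the limit
`C := lim_{z→∞} (Φ_0)_−(z)⋯(Φ_{kN−1})_−(z)` exists, is invertible, and for unit `z`, any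
`w` with `det(Φ(z)−wI)=0` and any right/left nullvectors evolved by the recursion
`ψ_{j+1,+} = (Φ_j)_+ ψ_{j,+}`, `ψ_{j+1,−} = ψ_{j,−} (Φ_j)_−`, one has
`z^{ℓN} C ψ_{kN,+} = φ̃_+(z) ψ_{0,+}` and `ψ_{kN,−} z^{−ℓN} C⁻¹ = ψ_{0,−} φ̃_−(z)`. -/
theorem statement11 (k ℓ N : ℕ) (hk : 1 ≤ k) [NeZero ℓ] (hN : 1 ≤ N)
    (α β γ : Fin k → Fin ℓ → ℝ)
    (hα : ∀ j i, 0 < α j i) (hβ : ∀ j i, 0 < β j i) (hγ : ∀ j i, 0 < γ j i)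
    (hass : ∀ i : Fin ℓ, (∏ j, β j i) < 1 ∧ 1 < (∏ j, α j i) / (∏ j, γ j i))
    (A B C : ℕ → Fin ℓ → Fin k → ℝ)
    (hApos : ∀ j < k * N, ∀ i m, 0 < A j i m)
    (hBpos : ∀ j < k * N, ∀ i m, 0 < B j i m)
    (hCpos : ∀ j < k * N, ∀ i m, 0 < C j i m)
    (hprod : ∀ j < k * N, ∀ i : Fin ℓ,
      (∏ m, B j i m) < 1 ∧ 1 < (∏ m, A j i m) / (∏ m, C j i m))
    (ΦSeq : ℕ → ℂ → Matrix (Fin k) (Fin k) ℂ)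
    (hΦ0 : ∀ z : ℂ, ΦSeq 0 z = prodPhiRange k ℓ α β γ z 0 (2 * ℓ))
    (hΦrec : ∀ (j : ℕ) (z : ℂ), ΦSeq (j + 1) z = Pplus k ℓ A C j z * Pminus k ℓ B j z)
    (hrefact : ∀ j < k * N, ∀ z : ℂ, z ≠ 0 →
      (∀ i : Fin ℓ, z ≠ ((∏ m, β m i : ℝ) : ℂ)) →
      (∀ j' < k * N, ∀ i : Fin ℓ, z ≠ ((∏ m, B j' i m : ℝ) : ℂ)) →
      ΦSeq j z = Pminus k ℓ B j z * Pplus k ℓ A C j z)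
    (φp φm : ℂ → Matrix (Fin k) (Fin k) ℂ)
    (hφp : ∃ U : Set ℂ, IsOpen U ∧ Metric.closedBall 0 1 ⊆ U ∧
      (∀ p q : Fin k, AnalyticOnNhd ℂ (fun z => φp z p q) U) ∧
      (∀ p q : Fin k, AnalyticOnNhd ℂ (fun z => (φp z)⁻¹ p q) U))
    (hφm : ∃ V : Set ℂ, IsOpen V ∧ {z : ℂ | 1 ≤ ‖z‖} ⊆ V ∧
      (∀ p q : Fin k, AnalyticOnNhd ℂ (fun z => φm z p q) V) ∧
      (∀ p q : Fin k, AnalyticOnNhd ℂ (fun z => (φm z)⁻¹ p q) V))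
    (hφmInf : ∀ p q : Fin k, Filter.Tendsto (fun z : ℂ => z ^ (ℓ * N) * φm z p q)
      (Bornology.cobounded ℂ) (nhds ((1 : Matrix (Fin k) (Fin k) ℂ) p q)))
    (hfact : ∀ z : ℂ, ‖z‖ = 1 →
      (prodPhiRange k ℓ α β γ z 0 (2 * ℓ)) ^ (k * N) = φm z * φp z) :
    ∃ Cmat : Matrix (Fin k) (Fin k) ℂ,
      (∀ p q : Fin k, Filter.Tendsto
        (fun z : ℂ => ((List.range (k * N)).map fun j => Pminus k ℓ B j z).prod p q)
        (Bornology.cobounded ℂ) (nhds (Cmat p q))) ∧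
      IsUnit Cmat ∧
      ∀ z : ℂ, ‖z‖ = 1 → ∀ w : ℂ,
        (prodPhiRange k ℓ α β γ z 0 (2 * ℓ) - w • (1 : Matrix (Fin k) (Fin k) ℂ)).det = 0 →
        ∀ ψp : Fin k → ℂ,
          (prodPhiRange k ℓ α β γ z 0 (2 * ℓ) - w • (1 : Matrix (Fin k) (Fin k) ℂ)).mulVec ψp
            = 0 →
        ∀ ψm : Fin k → ℂ,
          Matrix.vecMul ψm
            (prodPhiRange k ℓ α β γ z 0 (2 * ℓ) - w • (1 : Matrix (Fin k) (Fin k) ℂ)) = 0 →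
        ∀ ψpS : ℕ → Fin k → ℂ, ψpS 0 = ψp →
          (∀ j < k * N, ψpS (j + 1) = (Pplus k ℓ A C j z).mulVec (ψpS j)) →
        ∀ ψmS : ℕ → Fin k → ℂ, ψmS 0 = ψm →
          (∀ j < k * N, ψmS (j + 1) = Matrix.vecMul (ψmS j) (Pminus k ℓ B j z)) →
          z ^ (ℓ * N) • Cmat.mulVec (ψpS (k * N)) = (φp z).mulVec ψp ∧
          (z ^ (ℓ * N))⁻¹ • Matrix.vecMul (ψmS (k * N)) Cmat⁻¹ = Matrix.vecMul ψm (φm z) := by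
  have hne : ∀ z : ℂ, ‖z‖ = 1 → z ≠ 0 := fun z hz => norm_ne_zero_iff.1 (by simp [hz])
  have hreal : ∀ x : Fin k → ℝ, (∀ m, 0 < x m) → ‖((∏ m, x m : ℝ) : ℂ)‖ = ∏ m, x m :=
    fun x hx => by
      rw [Complex.norm_real, Real.norm_of_nonneg (Finset.prod_pos fun m _ => hx m).le]
  have hplus : ∀ j < k * N, ∀ z : ℂ, ‖z‖ = 1 → IsUnit (Pplus k ℓ A C j z) := by
    intro j hj z hz
    refine List.prod_isUnit fun m hm => ?_
    obtain ⟨i, rfl⟩ := (List.mem_ofFn' _ _).1 hm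
    refine isUnit_phiB z _ _ (fun m => Complex.ofReal_ne_zero.2 (hCpos j hj _ m).ne') ?_
    rw [← Complex.ofReal_prod, ← Complex.ofReal_prod, hreal _ (hApos j hj _),
      hreal _ (hCpos j hj _), hz, mul_one]
    have hpos : 0 < ∏ m, C j i.rev m := Finset.prod_pos fun m _ => hCpos j hj _ m
    exact ((one_lt_div hpos).1 (hprod j hj i.rev).2).ne'
  set P : ℕ → ℂ → Matrix (Fin k) (Fin k) ℂ := fun n z =>
    ((List.range n).reverse.map fun j => Pplus k ℓ A C j z).prod with hP
  set M : ℕ → ℂ → Matrix (Fin k) (Fin k) ℂ := fun n z =>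
    ((List.range n).map fun j => Pminus k ℓ B j z).prod with hM
  have hPsucc : ∀ n z, P (n + 1) z = Pplus k ℓ A C n z * P n z := fun n z => by
    simp [hP, List.range_succ]
  have hMsucc : ∀ n z, M (n + 1) z = M n z * Pminus k ℓ B n z := fun n z => by
    simp [hM, List.range_succ]
  have hPunit : ∀ z : ℂ, ‖z‖ = 1 → IsUnit (P (k * N) z) := by
    intro z hz
    refine List.prod_isUnit fun m hm => ?_
    obtain ⟨j, hj, rfl⟩ := List.mem_map.1 hm
    exact hplus j (by simpa using hj) z hz
  obtain ⟨Q, hQ⟩ : ∃ Q : Matrix (Fin k) (Fin k) (Polynomial ℂ),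
      ∀ z, z ≠ 0 → Q.map (Polynomial.eval z) = z ^ (ℓ * N) • P (k * N) z := by
    refine HasWinding.exists_polynomial ?_
    have hj : ∀ j, HasWinding ℓ (Pplus k ℓ A C j) := fun j => by
      have := HasWinding.list_prod (fun i : Fin ℓ => fun z =>
        phiB k z (fun m => (A j i.rev m : ℂ)) (fun m => (C j i.rev m : ℂ)))
        (fun i => HasWinding.phiB _ _) (List.finRange ℓ)
      rw [List.length_finRange, one_mul] at this
      have heq : Pplus k ℓ A C j = _ := funext fun z => congrArg List.prod List.ofFn_eq_map
      rwa [heq]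
    have := HasWinding.list_prod _ hj (List.range (k * N)).reverse
    rwa [List.length_reverse, List.length_range, mul_left_comm] at this
  obtain ⟨Minv, Cmat, D, hinv, hMinv, hMlim, hDlim⟩ : IsExteriorUnit (M (k * N)) := by
    refine IsExteriorUnit.list_prod (fun j => Pminus k ℓ B j) _ fun j hj => ?_
    rw [List.mem_range] at hj
    have := IsExteriorUnit.list_prod (fun i : Fin ℓ => fun z =>
      phiG k z (fun m => (B j i m : ℂ))) (List.finRange ℓ) fun i _ => IsExteriorUnit.phiG _ (by
        rw [← Complex.ofReal_prod, hreal _ (hBpos j hj _)]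
        exact (hprod j hj i).1)
    have heq : Pminus k ℓ B j = _ := funext fun z => congrArg List.prod List.ofFn_eq_map
    rwa [heq]
  have hDC : D * Cmat = 1 := by
    refine tendsto_nhds_unique (hDlim.mul hMlim) (tendsto_const_nhds.congr' ?_)
    filter_upwards [tendsto_norm_cobounded_atTop.eventually_ge_atTop 1] with z hz
    exact (hinv z hz).symm
  have hCD : Cmat * D = 1 := mul_eq_one_comm.1 hDC
  have hMP : ∀ z : ℂ, ‖z‖ = 1 → M (k * N) z * P (k * N) z = φm z * φp z := by
    intro z hz
    have hreal' : ∀ x : Fin k → ℝ, (∀ m, 0 < x m) → ∏ m, x m < 1 → z ≠ ((∏ m, x m : ℝ) : ℂ) := by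
      rintro x hx hlt rfl
      rw [hreal x hx] at hz
      exact hlt.ne hz
    rw [← hfact z hz, ← hΦ0]
    refine (pow_eq_mul_of_exchange (fun j => ΦSeq j z) (fun j => Pminus k ℓ B j z)
      (fun j => Pplus k ℓ A C j z) (fun j => M j z) (fun j => P j z) (k * N) (fun j hj => ?_)
      (fun j => hΦrec j z) (by simp [hM]) (fun j => hMsucc j z) (by simp [hP])
      (fun j => hPsucc j z) _ le_rfl).symm
    exact hrefact j hj z (hne z hz) (fun i => hreal' _ (fun m => hβ m i) (hass i).1)
      fun j' hj' i => hreal' _ (hBpos j' hj' i) (hprod j' hj' i).1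
  have hφpunit : ∀ z : ℂ, ‖z‖ = 1 → IsUnit (φp z) := by
    intro z hz
    have hu : IsUnit (φm z * φp z) :=
      hMP z hz ▸ (IsUnit.of_mul_eq_one_right _ (hinv z hz.ge)).mul (hPunit z hz)
    rw [Matrix.isUnit_iff_isUnit_det, Matrix.det_mul] at hu
    exact (Matrix.isUnit_iff_isUnit_det _).2 (isUnit_of_mul_isUnit_right hu)
  obtain ⟨U, -, hU, -, hφp⟩ := hφp
  obtain ⟨V, -, hV, hφm, -⟩ := hφm
  have hcircle : ∀ z : ℂ, ‖z‖ = 1 →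
      Q.map (Polynomial.eval z) * (φp z)⁻¹ = Minv z * (z ^ (ℓ * N) • φm z) := by
    intro z hz
    have hdet := (Matrix.isUnit_iff_isUnit_det _).1 (hφpunit z hz)
    rw [hQ z (hne z hz), Matrix.smul_mul, Matrix.mul_smul]
    congr 1
    rw [← Matrix.mul_nonsing_inv_cancel_right (φp z) (φm z) hdet, ← hMP z hz, ← mul_assoc,
      ← mul_assoc, hinv z hz.ge, one_mul]
  have hQD : ∀ z : ℂ, ‖z‖ = 1 → Q.map (Polynomial.eval z) * (φp z)⁻¹ = D := by
    intro z hz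
    ext p q
    refine eq_of_analyticAt_of_tendsto_cobounded
      (f := fun z => (Q.map (Polynomial.eval z) * (φp z)⁻¹) p q)
      (g := fun z => (Minv z * (z ^ (ℓ * N) • φm z)) p q) (fun z hz => ?_) (fun z hz => ?_) ?_
      (fun z hz => by rw [hcircle z hz]) hz.le
    · exact analyticAt_matrix_mul
        (fun i j => AnalyticOnNhd.eval_polynomial (Q i j) z (Set.mem_univ z))
        (fun i j => hφp i j z (hU (by simpa using hz))) p q
    · exact analyticAt_matrix_mul (hMinv z hz)
        (fun i j => (analyticAt_id.pow _).mul (hφm i j z (hV hz))) p q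
    · have := hDlim.mul (tendsto_matrix_iff.2 hφmInf)
      rw [mul_one] at this
      exact tendsto_matrix_iff.1 this p q
  have hplus_eq : ∀ z : ℂ, ‖z‖ = 1 → z ^ (ℓ * N) • (Cmat * P (k * N) z) = φp z := by
    intro z hz
    have hdet := (Matrix.isUnit_iff_isUnit_det _).1 (hφpunit z hz)
    rw [← Matrix.mul_smul, ← hQ z (hne z hz),
      ← Matrix.nonsing_inv_mul_cancel_right (φp z) (Q.map (Polynomial.eval z)) hdet,
      hQD z hz, ← mul_assoc, hCD, one_mul]
  have hminus_eq : ∀ z : ℂ, ‖z‖ = 1 → (z ^ (ℓ * N))⁻¹ • (M (k * N) z * D) = φm z := by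
    intro z hz
    rw [← hQD z hz, hcircle z hz, ← mul_assoc, mul_eq_one_comm.1 (hinv z hz.ge), one_mul,
      inv_smul_smul₀ (pow_ne_zero _ (hne z hz))]
  refine ⟨Cmat, tendsto_matrix_iff.1 hMlim, IsUnit.of_mul_eq_one _ hCD, ?_⟩
  intro z hz w _ ψp _ ψm _ ψpS hp0 hp ψmS hm0 hm
  have hpS : ∀ n ≤ k * N, ψpS n = (P n z).mulVec ψp := by
    intro n hn
    induction n with
    | zero => simp [hP, hp0]
    | succ n ih => rw [hp n hn, ih (by omega), hPsucc, Matrix.mulVec_mulVec]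
  have hmS : ∀ n ≤ k * N, ψmS n = Matrix.vecMul ψm (M n z) := by
    intro n hn
    induction n with
    | zero => simp [hM, hm0]
    | succ n ih => rw [hm n hn, ih (by omega), hMsucc, Matrix.vecMul_vecMul]
  rw [hpS _ le_rfl, hmS _ le_rfl, Matrix.inv_eq_right_inv hCD, Matrix.mulVec_mulVec,
    Matrix.vecMul_vecMul, ← Matrix.smul_mulVec, ← Matrix.vecMul_smul, hplus_eq z hz,
    hminus_eq z hz]
  exact ⟨rfl, rfl⟩
end

section
/- Let k ≥ 1, let A be a k×k complex matrix, let w ∈ ℂ, and let p(X) = det(X·I − A) be the characteristic polynomial of A. If the matrix wI − A has rank k−1, then adj(wI−A) is nonzero, trace(adj(wI−A)) = p'(w), and adj(wI−A)² = p'(w) · adj(wI−A). -/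
open scoped Matrix

namespace Matrix

variable {n : Type*} [Fintype n] [DecidableEq n]

/-- Jacobi's expansion: the derivative of a determinant is the sum of the determinants obtained by
differentiating one column. -/
theorem derivative_det {R : Type*} [CommRing R] (M : Matrix n n (Polynomial R)) :
    Polynomial.derivative M.det =
      ∑ j, (M.updateCol j fun i => Polynomial.derivative (M i j)).det := by
  simp_rw [det_apply', Polynomial.derivative_sum]
  rw [Finset.sum_comm]
  refine Finset.sum_congr rfl fun σ _ => ?_
  rw [Polynomial.derivative_intCast_mul, Polynomial.derivative_prod_finset, Finset.mul_sum]
  refine Finset.sum_congr rfl fun j _ => ?_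
  rw [← Finset.prod_erase_mul _ _ (Finset.mem_univ j), updateCol_self]
  congr 2
  refine Finset.prod_congr rfl fun i hi => ?_
  rw [updateCol_ne (Finset.ne_of_mem_erase hi)]

theorem derivative_charpoly {R : Type*} [CommRing R] (A : Matrix n n R) :
    Polynomial.derivative A.charpoly = A.charmatrix.adjugate.trace := by
  rw [charpoly, derivative_det, trace]
  refine Finset.sum_congr rfl fun j _ => ?_
  have h : (fun i => Polynomial.derivative (A.charmatrix i j)) = Pi.single j 1 := by
    ext1 i
    obtain rfl | hij := eq_or_ne i j
    · simp
    · simp [hij]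
  rw [h, ← cramer_apply, cramer_eq_adjugate_mulVec]
  simp

theorem eval_derivative_charpoly {R : Type*} [CommRing R] (A : Matrix n n R) (w : R) :
    (Polynomial.derivative A.charpoly).eval w = (w • (1 : Matrix n n R) - A).adjugate.trace := by
  have h : (Polynomial.evalRingHom w).mapMatrix A.charmatrix = w • (1 : Matrix n n R) - A := by
    ext i j
    obtain rfl | hij := eq_or_ne i j
    · simp
    · simp [hij]
  rw [derivative_charpoly, ← h, ← RingHom.map_adjugate, ← Polynomial.coe_evalRingHom,
    AddMonoidHom.map_trace]
  rfl

/-- The adjugate of a square matrix of corank one is a nonzero rank-one matrix. -/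
theorem exists_adjugate_eq_vecMulVec {K : Type*} [Field K] (M : Matrix n n K)
    (hM : M.rank + 1 = Fintype.card n) :
    ∃ u v : n → K, u ≠ 0 ∧ v ≠ 0 ∧ M.adjugate = vecMulVec u v := by
  classical
  obtain ⟨L, L', D, h⟩ := Pivot.exists_list_transvec_mul_diagonal_mul_list_transvec M
  set P := (L.map TransvectionStruct.toMatrix).prod
  set Q := (L'.map TransvectionStruct.toMatrix).prod
  have hP : P.det = 1 := TransvectionStruct.det_toMatrix_prod L
  have hQ : Q.det = 1 := TransvectionStruct.det_toMatrix_prod L'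
  have hcard : Fintype.card {i // D i = 0} = 1 := by
    have hr : M.rank = Fintype.card {i // D i ≠ 0} := by
      rw [h, rank_mul_eq_left_of_isUnit_det _ _ (by simp [hQ]),
        rank_mul_eq_right_of_isUnit_det _ _ (by simp [hP]), rank_diagonal]
    have hc := Fintype.card_subtype_compl fun i => D i = 0
    have hle := Fintype.card_subtype_le fun i => D i = 0
    simp only [ne_eq] at hr
    omega
  obtain ⟨⟨i, hi⟩, huniq⟩ := Fintype.card_eq_one_iff.mp hcard
  have hne : ∀ j, j ≠ i → D j ≠ 0 := fun j hj hD => hj (congrArg Subtype.val (huniq ⟨j, hD⟩))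
  set c := ∏ j ∈ Finset.univ.erase i, D j
  have hc : c ≠ 0 := Finset.prod_ne_zero_iff.mpr fun j hj => hne j (Finset.ne_of_mem_erase hj)
  have hD : (diagonal D).adjugate = vecMulVec (Pi.single i c) (Pi.single i 1) := by
    have hs : vecMulVec (Pi.single i c) (Pi.single i 1) = diagonal (Pi.single i c) := by
      rw [diagonal_single]
      ext a b
      simp [vecMulVec_apply, single_apply, Pi.single_apply, eq_comm, ite_and]
      split_ifs <;> rfl
    rw [adjugate_diagonal, hs]
    congr 1
    ext1 j
    obtain rfl | hj := eq_or_ne j i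
    · simp [c]
    · rw [Pi.single_eq_of_ne hj]
      exact Finset.prod_eq_zero (Finset.mem_erase.mpr ⟨hj.symm, Finset.mem_univ i⟩) hi
  refine ⟨Q.adjugate *ᵥ Pi.single i c, Pi.single i 1 ᵥ* P.adjugate, fun h0 => ?_, fun h0 => ?_, ?_⟩
  · have := congrArg (Q *ᵥ ·) h0
    simp [mulVec_mulVec, mul_adjugate, hQ, hc, -mulVec_single] at this
  · have := congrArg (· ᵥ* P) h0
    simp [vecMul_vecMul, adjugate_mul, hP, -single_vecMul] at this
  · rw [h, adjugate_mul_distrib, adjugate_mul_distrib, hD, vecMulVec_mul, mul_vecMulVec]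

theorem vecMulVec_sq {R : Type*} [CommRing R] (u v : n → R) :
    vecMulVec u v ^ 2 = (vecMulVec u v).trace • vecMulVec u v := by
  rw [sq, vecMulVec_mul_vecMulVec, trace_vecMulVec, dotProduct_comm, vecMulVec_smul]

end Matrix

/-- If `wI − A` has rank `k−1`, then `adj(wI−A) ≠ 0`,
`trace(adj(wI−A)) = p'(w)` where `p` is the characteristic polynomial of `A`, and
`adj(wI−A)² = p'(w)·adj(wI−A)`. -/
theorem statement12 (k : ℕ) (hk : 1 ≤ k) (A : Matrix (Fin k) (Fin k) ℂ) (w : ℂ)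
    (hrank : (w • (1 : Matrix (Fin k) (Fin k) ℂ) - A).rank = k - 1) :
    Matrix.adjugate (w • (1 : Matrix (Fin k) (Fin k) ℂ) - A) ≠ 0 ∧
    Matrix.trace (Matrix.adjugate (w • (1 : Matrix (Fin k) (Fin k) ℂ) - A)) =
      (Polynomial.derivative A.charpoly).eval w ∧
    Matrix.adjugate (w • (1 : Matrix (Fin k) (Fin k) ℂ) - A) ^ 2 =
      (Polynomial.derivative A.charpoly).eval w •
        Matrix.adjugate (w • (1 : Matrix (Fin k) (Fin k) ℂ) - A) := by
  obtain ⟨u, v, hu, hv, h⟩ := Matrix.exists_adjugate_eq_vecMulVec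
    (w • (1 : Matrix (Fin k) (Fin k) ℂ) - A) (by rw [hrank, Fintype.card_fin]; omega)
  rw [Matrix.eval_derivative_charpoly, h]
  exact ⟨Matrix.vecMulVec_ne_zero hu hv, rfl, Matrix.vecMulVec_sq u v⟩
end

section
/- Let k ≥ 1 and let A be a k×k complex matrix whose characteristic polynomial p(X) = det(X·I − A) has k distinct complex roots w_1,…,w_k. Then Σ_{i=1}^k adj(w_i·I − A)/p'(w_i) = I. -/
open scoped Matrix

open Polynomial in
/-- An eigenvector `v` of `A` with eigenvalue `μ` is an eigenvector of `adj (x I - A)`, with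
eigenvalue the value at `x` of the cofactor of `X - μ` in the characteristic polynomial. -/
theorem Matrix.adjugate_smul_one_sub_mulVec {n R : Type*} [Fintype n] [DecidableEq n] [CommRing R]
    {A : Matrix n n R} {v : n → R} {μ : R} (hv : A *ᵥ v = μ • v) {q : R[X]}
    (hq : A.charpoly = (X - C μ) * q) (x : R) :
    (x • (1 : Matrix n n R) - A).adjugate *ᵥ v = q.eval x • v := by
  have hchar : A.charmatrix *ᵥ (C ∘ v) = (X - C μ) • (C ∘ v) := by
    have hmap : A.map C *ᵥ (C ∘ v) = C μ • (C ∘ v) := by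
      ext1 i
      have := congrArg C (congrFun hv i)
      rw [RingHom.map_mulVec] at this
      simpa using this
    have hdef : A.charmatrix = Matrix.scalar n X - A.map C := rfl
    rw [hdef, Matrix.sub_mulVec, hmap, sub_smul, Matrix.scalar_apply, ← Matrix.smul_one_eq_diagonal,
      Matrix.smul_mulVec, Matrix.one_mulVec]
  have hadj : A.charmatrix.adjugate *ᵥ (C ∘ v) = q • (C ∘ v) := by
    have h : A.charmatrix.adjugate *ᵥ (A.charmatrix *ᵥ (C ∘ v)) = A.charpoly • (C ∘ v) := by
      rw [Matrix.mulVec_mulVec, Matrix.adjugate_mul, Matrix.smul_mulVec, Matrix.one_mulVec,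
        Matrix.charpoly]
    rw [hchar, Matrix.mulVec_smul, hq, mul_smul] at h
    ext1 i
    exact (monic_X_sub_C μ).isRegular.left (congrFun h i)
  have heval : A.charmatrix.map (evalRingHom x) = x • (1 : Matrix n n R) - A := by
    ext i j
    by_cases hij : i = j <;> simp [hij]
  ext1 i
  have h := congrArg (evalRingHom x) (congrFun hadj i)
  rw [RingHom.map_mulVec, ← RingHom.mapMatrix_apply, RingHom.map_adjugate,
    RingHom.mapMatrix_apply, heval] at h
  have hcomp : ⇑(evalRingHom x) ∘ (C ∘ v) = v := by
    ext1 j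
    simp
  rw [hcomp] at h
  simpa using h

/-- If the characteristic polynomial `p` of `A` has `k` distinct roots `w_1,…,w_k`, then
`Σ_i adj(w_i I − A)/p'(w_i) = I`. -/
theorem statement13 (k : ℕ) (hk : 1 ≤ k) (A : Matrix (Fin k) (Fin k) ℂ)
    (w : Fin k → ℂ) (hinj : Function.Injective w)
    (hroot : ∀ i, (A.charpoly).eval (w i) = 0) :
    ∑ i : Fin k, ((Polynomial.derivative A.charpoly).eval (w i))⁻¹ •
        Matrix.adjugate (w i • (1 : Matrix (Fin k) (Fin k) ℂ) - A) =
      (1 : Matrix (Fin k) (Fin k) ℂ) := by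
  have hexists : ∀ i, ∃ v : Fin k → ℂ, v ≠ 0 ∧ A *ᵥ v = w i • v := by
    intro i
    have hdet := hroot i
    rw [Matrix.eval_charpoly] at hdet
    obtain ⟨v, hv, h⟩ := Matrix.exists_mulVec_eq_zero_iff.mpr hdet
    refine ⟨v, hv, ?_⟩
    rw [Matrix.sub_mulVec, sub_eq_zero, Matrix.scalar_apply, ← Matrix.smul_one_eq_diagonal,
      Matrix.smul_mulVec, Matrix.one_mulVec] at h
    exact h.symm
  choose v hv0 hv using hexists
  have hli : LinearIndependent ℂ v :=
    Module.End.eigenvectors_linearIndependent' (Matrix.toLin' A) w hinj v fun i =>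
      ⟨Module.End.mem_eigenspace_iff.mpr (by simpa using hv i), hv0 i⟩
  have : Nonempty (Fin k) := ⟨⟨0, hk⟩⟩
  let b := basisOfLinearIndependentOfCardEqFinrank hli (by simp)
  have hprod : A.charpoly = Lagrange.nodal Finset.univ w := by
    refine Polynomial.eq_of_degree_sub_lt_of_eval_index_eq Finset.univ hinj.injOn ?_ fun i _ => ?_
    · have hdeg : A.charpoly.degree = (Lagrange.nodal Finset.univ w).degree := by
        simp [Matrix.charpoly_degree_eq_dim]
      refine (Polynomial.degree_sub_lt_left hdeg A.charpoly_monic.ne_zero ?_).trans_eq ?_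
      · rw [A.charpoly_monic.leadingCoeff, Lagrange.nodal_monic.leadingCoeff]
      · simp [Matrix.charpoly_degree_eq_dim]
    · rw [hroot, Lagrange.eval_nodal_at_node (Finset.mem_univ i)]
  apply Matrix.toLin'.injective
  refine b.ext fun j => ?_
  have hbj : b j = v j := by simp [b]
  have hcofactor : A.charpoly = (Polynomial.X - Polynomial.C (w j)) *
      Lagrange.nodal (Finset.univ.erase j) w := by
    rw [hprod, Lagrange.nodal_eq_mul_nodal_erase (Finset.mem_univ j)]
  have hadj := Matrix.adjugate_smul_one_sub_mulVec (hv j) hcofactor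
  rw [hbj, Matrix.toLin'_apply, Matrix.toLin'_apply, Matrix.one_mulVec, Matrix.sum_mulVec]
  simp_rw [Matrix.smul_mulVec, hadj]
  rw [Finset.sum_eq_single j]
  · have hne : (Lagrange.nodal (Finset.univ.erase j) w).eval (w j) ≠ 0 :=
      Lagrange.eval_nodal_not_at_node fun i hi h =>
        Finset.ne_of_mem_erase hi (hinj h).symm
    rw [hprod, Lagrange.eval_nodal_derivative_eval_node_eq (Finset.mem_univ j),
      inv_smul_smul₀ hne]
  · intro i _ hij
    rw [Lagrange.eval_nodal_at_node (Finset.mem_erase.mpr ⟨hij, Finset.mem_univ i⟩), zero_smul,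
      smul_zero]
  · simp
end

section
/- Let k ≥ 1, let A be a k×k complex matrix, and let w, w* ∈ ℂ be two distinct eigenvalues of A. Then adj(wI−A) · adj(w*I−A) = 0. -/
open scoped Matrix

theorem det_smul_one_sub_eq_zero_of_mem_spectrum {n K : Type*} [Fintype n] [DecidableEq n]
    [Field K] {A : Matrix n n K} {w : K} (hw : w ∈ spectrum K A) :
    (w • (1 : Matrix n n K) - A).det = 0 := by
  rwa [spectrum.mem_iff, Algebra.algebraMap_eq_smul_one, Matrix.isUnit_iff_isUnit_det,
    isUnit_iff_ne_zero, not_not] at hw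

/-- If `w ≠ w*` are two distinct eigenvalues of `A`, then
`adj(wI−A) · adj(w*I−A) = 0`. -/
theorem statement14 (k : ℕ) (hk : 1 ≤ k) (A : Matrix (Fin k) (Fin k) ℂ)
    (w w' : ℂ) (hw : w ∈ spectrum ℂ A) (hw' : w' ∈ spectrum ℂ A) (hne : w ≠ w') :
    Matrix.adjugate (w • (1 : Matrix (Fin k) (Fin k) ℂ) - A) *
      Matrix.adjugate (w' • (1 : Matrix (Fin k) (Fin k) ℂ) - A) = 0 := by
  set P := w • (1 : Matrix (Fin k) (Fin k) ℂ) - A with hP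
  set Q := w' • (1 : Matrix (Fin k) (Fin k) ℂ) - A with hQ
  have hPadj : P.adjugate * P = 0 := by
    rw [Matrix.adjugate_mul, det_smul_one_sub_eq_zero_of_mem_spectrum hw, zero_smul]
  have hQadj : Q * Q.adjugate = 0 := by
    rw [Matrix.mul_adjugate, det_smul_one_sub_eq_zero_of_mem_spectrum hw', zero_smul]
  have hsub : P - Q = (w - w') • 1 := by
    rw [hP, hQ, sub_smul]
    abel
  have hsmul : (w - w') • (P.adjugate * Q.adjugate) = 0 := by
    calc (w - w') • (P.adjugate * Q.adjugate) = P.adjugate * (P - Q) * Q.adjugate := by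
          rw [hsub, Matrix.mul_smul, Matrix.mul_one, Matrix.smul_mul]
      _ = 0 := by
          rw [Matrix.mul_sub, hPadj, zero_sub, Matrix.neg_mul, Matrix.mul_assoc, hQadj,
            Matrix.mul_zero, neg_zero]
  exact (smul_eq_zero.mp hsmul).resolve_left (sub_ne_zero.mpr hne)
end

section
/- Let k ≥ 1, let A be a k×k complex matrix whose characteristic polynomial p(X) = det(X·I − A) has k distinct complex roots w_1,…,w_k, let m ≥ 0 be an integer, and let r > 0 satisfy |w_i| ≠ r for all i. Then (1/2πi) ∮_{|w|=r} (wI − A)^{−1} w^m dw = Σ_{i : |w_i| < r} w_i^m · adj(w_i·I − A)/p'(w_i), the circle being positively oriented. -/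
open scoped Matrix

open Polynomial in
/-- A monic polynomial vanishing at as many distinct points as its degree is their nodal
polynomial. -/
theorem Polynomial.Monic.eq_nodal {F ι : Type*} [Field F] [Fintype ι] {p : F[X]} (hp : p.Monic)
    (hdeg : p.natDegree = Fintype.card ι) {w : ι → F} (hw : Function.Injective w)
    (hroot : ∀ i, p.eval (w i) = 0) : p = Lagrange.nodal Finset.univ w := by
  have hpdeg : p.degree = (Finset.univ : Finset ι).card := by
    rw [degree_eq_natDegree hp.ne_zero, hdeg, Finset.card_univ]
  refine Polynomial.eq_of_degree_le_of_eval_index_eq Finset.univ hw.injOn hpdeg.le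
    (hpdeg.trans Lagrange.degree_nodal.symm) ?_ fun i hi => ?_
  · rw [hp.leadingCoeff, Lagrange.nodal_monic.leadingCoeff]
  · rw [hroot, Lagrange.eval_nodal_at_node hi]

open Polynomial in
/-- Partial fraction decomposition of `f / ∏ i ∈ s, (X - v i)` at a point off the nodes. -/
theorem Lagrange.eval_div_eval_nodal {F ι : Type*} [Field F] [DecidableEq ι] {s : Finset ι}
    {v : ι → F} (hv : Set.InjOn v s) (f : F[X]) {x : F} (hx : ∀ i ∈ s, x ≠ v i) :
    f.eval x / (nodal s v).eval x = (f /ₘ nodal s v).eval x +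
      ∑ i ∈ s, f.eval (v i) * ((nodal s v).derivative.eval (v i))⁻¹ * (x - v i)⁻¹ := by
  have hne : (nodal s v).eval x ≠ 0 := by
    rw [eval_nodal, Finset.prod_ne_zero_iff]
    exact fun i hi => sub_ne_zero.2 (hx i hi)
  have hmod : f %ₘ nodal s v = interpolate s v fun i => f.eval (v i) := by
    refine eq_interpolate_of_eval_eq _ hv ?_ fun i hi => ?_
    · simpa only [degree_nodal] using degree_modByMonic_lt f (nodal_monic (s := s) (v := v))
    · rw [modByMonic_eq_sub_mul_div, eval_sub, eval_mul, eval_nodal_at_node hi,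
        zero_mul, sub_zero]
  rw [div_eq_iff hne]
  conv_lhs => rw [← modByMonic_add_div f (nodal s v)]
  rw [eval_add, eval_mul, hmod, eval_interpolate_not_at_node _ hx, add_comm, add_mul, mul_comm]
  congr 1
  rw [mul_comm]
  congr 1
  refine Finset.sum_congr rfl fun i hi => ?_
  rw [nodalWeight_eq_eval_derivative_nodal hi]
  ring

/-- The integral of `(z - w)⁻¹` over a circle vanishes when `w` lies outside the closed disk. -/
theorem circleIntegral.integral_sub_inv_of_notMem_closedBall {c w : ℂ} {R : ℝ} (hR : 0 ≤ R)
    (hw : w ∉ Metric.closedBall c R) : (∮ z in C(c, R), (z - w)⁻¹) = 0 := by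
  have hne : ∀ z ∈ Metric.closedBall c R, z - w ≠ 0 := fun z hz h =>
    hw (sub_eq_zero.1 h ▸ hz)
  refine Complex.circleIntegral_eq_zero_of_differentiable_on_off_countable hR
    Set.countable_empty ?_ fun z hz => ?_
  · exact (continuousOn_id.sub continuousOn_const).inv₀ hne
  · exact (differentiableAt_id.sub_const w).inv (hne z (Metric.ball_subset_closedBall hz.1))

open Polynomial in
/-- Residue theorem for a rational function with simple poles. -/
theorem circleIntegral.integral_eval_div_eval_nodal {ι : Type*} [DecidableEq ι] {s : Finset ι}
    {v : ι → ℂ} (hv : Set.InjOn v s) (f : ℂ[X]) {r : ℝ} (hr : 0 < r)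
    (hvr : ∀ i ∈ s, ‖v i‖ ≠ r) :
    (∮ z in C(0, r), f.eval z / (Lagrange.nodal s v).eval z) =
      2 * Real.pi * Complex.I * ∑ i ∈ s with ‖v i‖ < r,
        f.eval (v i) * ((Lagrange.nodal s v).derivative.eval (v i))⁻¹ := by
  have hint : ∀ i ∈ s, CircleIntegrable (fun z => f.eval (v i) *
      ((Lagrange.nodal s v).derivative.eval (v i))⁻¹ * (z - v i)⁻¹) 0 r := fun i hi =>
    (circleIntegrable_sub_inv_iff.2 (Or.inr (by
      simpa [abs_of_pos hr] using hvr i hi))).const_fun_smul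
  have hq := (f /ₘ Lagrange.nodal s v).differentiable
  rw [circleIntegral.integral_congr hr.le (g := fun z => (f /ₘ Lagrange.nodal s v).eval z +
      ∑ i ∈ s, f.eval (v i) * ((Lagrange.nodal s v).derivative.eval (v i))⁻¹ * (z - v i)⁻¹)
      fun z hz => Lagrange.eval_div_eval_nodal hv f fun i hi h => hvr i hi (by
        rw [← h]; simpa using hz),
    circleIntegral.integral_add (hq.continuous.continuousOn.circleIntegrable hr.le)
      (CircleIntegrable.fun_sum _ hint),
    Complex.circleIntegral_eq_zero_of_differentiable_on_off_countable hr.le Set.countable_empty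
      hq.continuous.continuousOn fun z _ => hq z,
    zero_add, circleIntegral.integral_fun_sum hint, Finset.sum_filter, Finset.mul_sum]
  refine Finset.sum_congr rfl fun i hi => ?_
  rw [circleIntegral.integral_const_mul]
  split_ifs with h
  · rw [circleIntegral.integral_sub_inv_of_mem_ball (by simpa using h), mul_comm]
  · have : v i ∉ Metric.closedBall (0 : ℂ) r := by
      simpa using lt_of_le_of_ne (not_lt.1 h) (hvr i hi).symm
    rw [circleIntegral.integral_sub_inv_of_notMem_closedBall hr.le this, mul_zero, mul_zero]

/-- Evaluating the adjugate of the characteristic matrix. -/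
theorem Matrix.eval_adjugate_charmatrix {R n : Type*} [CommRing R] [Fintype n] [DecidableEq n]
    (A : Matrix n n R) (x : R) (i j : n) :
    (A.charmatrix.adjugate i j).eval x = (x • (1 : Matrix n n R) - A).adjugate i j := by
  have h := (Polynomial.evalRingHom x).map_adjugate A.charmatrix
  have hA : (Polynomial.evalRingHom x).mapMatrix A.charmatrix = x • (1 : Matrix n n R) - A := by
    ext a b
    by_cases hab : a = b <;> simp [hab]
  rw [hA] at h
  exact congrFun (congrFun h i) j

/-- Residue expansion of the resolvent: if the characteristic polynomial `p` of `A` has `k`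
distinct roots `w_1,…,w_k`, none of modulus `r`, then for every `m ≥ 0`,
`(1/2πi) ∮_{|w|=r} (wI−A)⁻¹ w^m dw = Σ_{i : |w_i|<r} w_i^m · adj(w_i I − A)/p'(w_i)`
(the matrix contour integral being taken entrywise). -/
theorem statement15 (k : ℕ) (hk : 1 ≤ k) (A : Matrix (Fin k) (Fin k) ℂ)
    (w : Fin k → ℂ) (hinj : Function.Injective w)
    (hroot : ∀ i, (A.charpoly).eval (w i) = 0)
    (m : ℕ) (r : ℝ) (hr : 0 < r) (hri : ∀ i, ‖w i‖ ≠ r) :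
    (Matrix.of fun p q : Fin k =>
        (2 * (Real.pi : ℂ) * Complex.I)⁻¹ *
          circleIntegral
            (fun ζ : ℂ =>
              ((ζ • (1 : Matrix (Fin k) (Fin k) ℂ) - A)⁻¹) p q * ζ ^ m) 0 r) =
      ∑ i ∈ Finset.univ.filter fun i : Fin k => ‖w i‖ < r,
        ((w i) ^ m * (((Polynomial.derivative A.charpoly).eval (w i))⁻¹)) •
          Matrix.adjugate (w i • (1 : Matrix (Fin k) (Fin k) ℂ) - A) := by
  have hnodal : A.charpoly = Lagrange.nodal Finset.univ w :=
    A.charpoly_monic.eq_nodal A.charpoly_natDegree_eq_dim hinj hroot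
  ext p q
  have hfun : ∀ ζ : ℂ, (ζ • (1 : Matrix (Fin k) (Fin k) ℂ) - A)⁻¹ p q * ζ ^ m =
      (A.charmatrix.adjugate p q * Polynomial.X ^ m).eval ζ /
        (Lagrange.nodal Finset.univ w).eval ζ := fun ζ => by
    rw [← hnodal, Matrix.eval_charpoly, Matrix.inv_def, Polynomial.eval_mul,
      Matrix.eval_adjugate_charmatrix, Polynomial.eval_pow, Polynomial.eval_X, Matrix.smul_apply,
      Ring.inverse_eq_inv', smul_eq_mul, Matrix.smul_one_eq_diagonal, Matrix.scalar_apply]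
    ring
  simp only [Matrix.of_apply, hfun]
  rw [circleIntegral.integral_eval_div_eval_nodal hinj.injOn _ hr fun i _ => hri i,
    inv_mul_cancel_left₀ Complex.two_pi_I_ne_zero, Matrix.sum_apply, ← hnodal]
  refine Finset.sum_congr rfl fun i _ => ?_
  rw [Polynomial.eval_mul, Matrix.eval_adjugate_charmatrix, Polynomial.eval_pow,
    Polynomial.eval_X, Matrix.smul_apply, smul_eq_mul]
  ring
end

section
/- For every z ∈ ℂ with z ≠ 0 and z ≠ β^v_i for all i = 1,…,ℓ: P(z,0) = ∏_{i=1}^ℓ (γ^v_i − (−1)^k α^v_i z^{−1}); in particular, for z in this domain, P(z,0) = 0 if and only if z = (−1)^k α^v_i/γ^v_i for some i ∈ {1,…,ℓ}. -/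
open scoped BigOperators Matrix

/-- `Φ(z) = φ_1(z)φ_2(z)⋯φ_{2ℓ}(z)` where `φ_{2i−1}(z) = φ^b(z;α⃗_i,γ⃗_i)` and
`φ_{2i}(z) = φ^g(z;β⃗_i)`. -/
noncomputable def PhiM (k ℓ : ℕ) (α β γ : Fin k → Fin ℓ → ℝ) (z : ℂ) :
    Matrix (Fin k) (Fin k) ℂ :=
  (List.ofFn fun i : Fin ℓ =>
    phiB k z (fun j => (α j i : ℂ)) (fun j => (γ j i : ℂ)) *
      phiG k z (fun j => (β j i : ℂ))).prod

/-- The characteristic polynomial `P(z,w) = ∏_{i=1}^ℓ (1−β^v_i z⁻¹) · det(Φ(z)−wI)`. -/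
noncomputable def PP (k ℓ : ℕ) (α β γ : Fin k → Fin ℓ → ℝ) (z w : ℂ) : ℂ :=
  (∏ i : Fin ℓ, (1 - (∏ j, (β j i : ℂ)) * z⁻¹)) *
    (PhiM k ℓ α β γ z - w • (1 : Matrix (Fin k) (Fin k) ℂ)).det

theorem det_phiB_succ (n : ℕ) (z : ℂ) (α γ : Fin (n + 1) → ℂ) :
    (phiB (n + 1) z α γ).det =
      (∏ j, γ j) - (-1 : ℂ) ^ (n + 1) * (∏ j, α j) * z⁻¹ := by
  have row_zero : ∀ j : Fin (n + 1), phiB (n + 1) z α γ 0 j =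
      (if j = 0 then γ 0 else 0) + (if j = Fin.last n then α j * z⁻¹ else 0) := by
    intro j
    simp only [phiB, Matrix.of_apply, Fin.ext_iff, Fin.val_zero, Fin.val_last]
    grind
  have minor_zero : ((phiB (n + 1) z α γ).submatrix Fin.succ (Fin.succAbove 0)).det =
      ∏ j : Fin n, γ j.succ := by
    rw [Matrix.det_of_isLowerTriangular]
    · simp [phiB]
    · intro i j hij
      have hij' : (i : ℕ) < j := hij
      have h1 : i ≠ j := fun h => by subst h; omega
      have h2 : (i : ℕ) ≠ j + 1 := by omega
      simp [phiB, h1, h2]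
  have minor_last :
      ((phiB (n + 1) z α γ).submatrix Fin.succ (Fin.succAbove (Fin.last n))).det =
      ∏ j : Fin n, α j.castSucc := by
    rw [Matrix.det_of_isUpperTriangular]
    · simp [phiB, Fin.ext_iff, -Fin.val_eq_zero_iff]
    · intro i j hij
      have hij' : (j : ℕ) < i := hij
      have h1 : (i : ℕ) + 1 ≠ j := by omega
      have h2 : (i : ℕ) ≠ j := by omega
      simp [phiB, Fin.ext_iff, -Fin.val_eq_zero_iff, h1, h2]
  rw [Matrix.det_succ_row_zero]
  simp only [row_zero, mul_add, add_mul, Finset.sum_add_distrib, mul_ite, ite_mul, mul_zero,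
    zero_mul, Finset.sum_ite_eq', Finset.mem_univ, if_true, minor_zero, minor_last]
  rw [Fin.prod_univ_succ γ, Fin.prod_univ_castSucc α]
  simp only [Fin.val_zero, Fin.val_last, pow_zero, pow_succ]
  ring

theorem det_phiB {k : ℕ} (hk : 1 ≤ k) (z : ℂ) (α γ : Fin k → ℂ) :
    (phiB k z α γ).det = (∏ j, γ j) - (-1 : ℂ) ^ k * (∏ j, α j) * z⁻¹ := by
  obtain ⟨n, rfl⟩ := Nat.exists_eq_add_of_le' hk
  exact det_phiB_succ n z α γ

theorem bval_val {k : ℕ} (β : Fin k → ℂ) (j : Fin k) : bval β j = β j := by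
  simp [bval]

theorem prod_Ico_bval {k : ℕ} (β : Fin k → ℂ) : ∏ m ∈ Finset.Ico 0 k, bval β m = ∏ j, β j := by
  rw [← Finset.range_eq_Ico, Finset.prod_range]
  simp [bval_val]

theorem mul_phiB_apply_castSucc {n : ℕ} (M : Matrix (Fin (n + 1)) (Fin (n + 1)) ℂ) (z : ℂ)
    (α γ : Fin (n + 1) → ℂ) (i : Fin (n + 1)) (j : Fin n) :
    (M * phiB (n + 1) z α γ) i j.castSucc =
      M i j.castSucc * γ j.castSucc + M i j.succ * α j.castSucc := by
  have column : ∀ x : Fin (n + 1), phiB (n + 1) z α γ x j.castSucc =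
      (if x = j.castSucc then γ j.castSucc else 0) +
        (if x = j.succ then α j.castSucc else 0) := by
    intro x
    have hγ : x = j.castSucc → γ x = γ j.castSucc := congrArg γ
    simp only [phiB, Matrix.of_apply, Fin.ext_iff, Fin.val_castSucc, Fin.val_succ] at hγ ⊢
    grind
  simp [Matrix.mul_apply, column, mul_add, Finset.sum_add_distrib]

theorem mul_phiB_apply_last {n : ℕ} (M : Matrix (Fin (n + 1)) (Fin (n + 1)) ℂ) (z : ℂ)
    (α γ : Fin (n + 1) → ℂ) (i : Fin (n + 1)) :
    (M * phiB (n + 1) z α γ) i (Fin.last n) =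
      M i (Fin.last n) * γ (Fin.last n) + M i 0 * (α (Fin.last n) * z⁻¹) := by
  have column : ∀ x : Fin (n + 1), phiB (n + 1) z α γ x (Fin.last n) =
      (if x = Fin.last n then γ (Fin.last n) else 0) +
        (if x = 0 then α (Fin.last n) * z⁻¹ else 0) := by
    intro x
    simp only [phiB, Matrix.of_apply, Fin.ext_iff, Fin.val_last, Fin.val_zero]
    grind
  simp [Matrix.mul_apply, column, mul_add, Finset.sum_add_distrib]

theorem phiG_mul_phiB_neg (n : ℕ) (z : ℂ) (β : Fin (n + 1) → ℂ)
    (h : 1 - (∏ j, β j) * z⁻¹ ≠ 0) :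
    phiG (n + 1) z β * phiB (n + 1) z (fun j => -β j) (fun _ => 1) = 1 := by
  rw [phiG, Matrix.smul_mul, inv_smul_eq_iff₀ h]
  ext i j
  induction j using Fin.lastCases with
  | last =>
    rw [mul_phiB_apply_last]
    by_cases hi : i = Fin.last n
    · subst hi
      have key : (∏ m ∈ Finset.Ico 0 n, bval β m) * β (Fin.last n) = ∏ j, β j := by
        rw [← prod_Ico_bval, Finset.prod_Ico_succ_top (Nat.zero_le n), ← bval_val β (Fin.last n),
          Fin.val_last]
      simp only [Matrix.of_apply, Matrix.smul_apply, Matrix.one_apply_eq, ← key]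
      simp
      ring
    · have hlt : (i : ℕ) < n := Fin.val_lt_last hi
      have key : bval β n = β (Fin.last n) := bval_val β (Fin.last n)
      simp [hi, key]
      ring
  | cast j =>
    rw [mul_phiB_apply_castSucc]
    have hj : bval β j = β j.castSucc := bval_val β j.castSucc
    rcases lt_trichotomy (i : ℕ) j with hij | hij | hij
    · have hne : i ≠ j.castSucc := fun h => by simp [h] at hij
      have h1 : ¬ (j : ℕ) ≤ i := by omega
      have h2 : ¬ (j : ℕ) + 1 ≤ i := by omega
      have key := Finset.prod_eq_prod_Ico_succ_bot (show (j : ℕ) < n + 1 by omega) (bval β)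
      simp only [Matrix.of_apply, Matrix.smul_apply, Matrix.one_apply_ne hne, Fin.val_castSucc,
        Fin.val_succ, if_neg h1, if_neg h2, key, hj, smul_zero]
      ring
    · obtain rfl : i = j.castSucc := Fin.ext hij
      have key : (∏ m ∈ Finset.Ico 0 (j : ℕ), bval β m) *
          (β j.castSucc * ∏ m ∈ Finset.Ico ((j : ℕ) + 1) (n + 1), bval β m) = ∏ j, β j := by
        rw [← hj, ← Finset.prod_eq_prod_Ico_succ_bot (show (j : ℕ) < n + 1 by omega) (bval β),
          Finset.prod_Ico_consecutive _ (Nat.zero_le _) (by omega), prod_Ico_bval]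
      have h2 : ¬ (j : ℕ) + 1 ≤ j := by omega
      simp only [Matrix.of_apply, Matrix.smul_apply, Matrix.one_apply_eq, Fin.val_castSucc,
        Fin.val_succ, le_refl, if_true, if_neg h2, Finset.Ico_self, Finset.prod_empty, ← key,
        smul_eq_mul]
      ring
    · have hne : i ≠ j.castSucc := fun h => by simp [h] at hij
      have h1 : (j : ℕ) ≤ i := by omega
      have h2 : (j : ℕ) + 1 ≤ i := by omega
      have key := Finset.prod_eq_prod_Ico_succ_bot hij (bval β)
      simp only [Matrix.of_apply, Matrix.smul_apply, Matrix.one_apply_ne hne, Fin.val_castSucc,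
        Fin.val_succ, if_pos h1, if_pos h2, key, hj, smul_zero]
      ring

theorem mul_det_phiG {k : ℕ} (hk : 1 ≤ k) (z : ℂ) (β : Fin k → ℂ)
    (h : 1 - (∏ j, β j) * z⁻¹ ≠ 0) :
    (1 - (∏ j, β j) * z⁻¹) * (phiG k z β).det = 1 := by
  obtain ⟨n, rfl⟩ := Nat.exists_eq_add_of_le' hk
  have hdet := congrArg Matrix.det (phiG_mul_phiB_neg n z β h)
  have hsign : (-1 : ℂ) ^ (n + 1) * ∏ j, -β j = ∏ j, β j := by
    rw [Finset.prod_neg, Finset.card_univ, Fintype.card_fin, ← mul_assoc, ← mul_pow]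
    simp
  rw [Matrix.det_mul, det_phiB_succ, Matrix.det_one, hsign] at hdet
  simpa [mul_comm] using hdet

/-- `P(z,0) = ∏_{i=1}^ℓ (γ^v_i − (−1)^k α^v_i z⁻¹)`; in particular `P(z,0) = 0` iff
`z = (−1)^k α^v_i/γ^v_i` for some `i`. -/
theorem statement16 (k ℓ : ℕ) (hk : 1 ≤ k) (hℓ : 1 ≤ ℓ)
    (α β γ : Fin k → Fin ℓ → ℝ)
    (hα : ∀ j i, 0 < α j i) (hβ : ∀ j i, 0 < β j i) (hγ : ∀ j i, 0 < γ j i)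
    (z : ℂ) (hz : z ≠ 0) (hzβ : ∀ i : Fin ℓ, z ≠ ∏ j, (β j i : ℂ)) :
    PP k ℓ α β γ z 0 =
      ∏ i : Fin ℓ, ((∏ j, (γ j i : ℂ)) - (-1 : ℂ) ^ k * (∏ j, (α j i : ℂ)) * z⁻¹) ∧
    (PP k ℓ α β γ z 0 = 0 ↔
      ∃ i : Fin ℓ, z = (-1 : ℂ) ^ k * (∏ j, (α j i : ℂ)) / ∏ j, (γ j i : ℂ)) := by
  have hPP : PP k ℓ α β γ z 0 =
      ∏ i : Fin ℓ, ((∏ j, (γ j i : ℂ)) - (-1 : ℂ) ^ k * (∏ j, (α j i : ℂ)) * z⁻¹) := by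
    have hdet : (PhiM k ℓ α β γ z).det = ∏ i : Fin ℓ,
        (phiB k z (fun j => (α j i : ℂ)) (fun j => (γ j i : ℂ)) *
          phiG k z (fun j => (β j i : ℂ))).det := by
      rw [PhiM, ← Matrix.coe_detMonoidHom, map_list_prod, List.map_ofFn, List.prod_ofFn]
      rfl
    rw [PP, zero_smul, sub_zero, hdet, ← Finset.prod_mul_distrib]
    refine Finset.prod_congr rfl fun i _ => ?_
    have h : 1 - (∏ j, (β j i : ℂ)) * z⁻¹ ≠ 0 := by
      rw [sub_ne_zero, ← div_eq_mul_inv]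
      exact fun h => hzβ i ((eq_div_iff hz).mp h ▸ (one_mul z).symm)
    rw [Matrix.det_mul, det_phiB hk, mul_left_comm, mul_det_phiG hk z _ h, mul_one]
  refine ⟨hPP, ?_⟩
  rw [hPP, Finset.prod_eq_zero_iff]
  simp only [Finset.mem_univ, true_and]
  refine exists_congr fun i => ?_
  have hγi : (∏ j, (γ j i : ℂ)) ≠ 0 :=
    Finset.prod_ne_zero_iff.mpr fun j _ => Complex.ofReal_ne_zero.mpr (hγ j i).ne'
  rw [sub_eq_zero, ← div_eq_mul_inv, eq_div_iff hz, eq_div_iff hγi, mul_comm]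
end

section
/- There is a polynomial Q ∈ ℂ[z,w] with Q(z,w) = z^ℓ · P(z,w) for all z ∈ ℂ∖({0} ∪ {β^v_1,…,β^v_ℓ}) and all w ∈ ℂ, and Q satisfies: its degree in w is k, with the coefficient of w^k equal to the polynomial (−1)^k ∏_{i=1}^ℓ (z − β^v_i) in z; its degree in z is ℓ; and Q(z,0) = ∏_{i=1}^ℓ (γ^v_i z − (−1)^k α^v_i). In particular the coefficients of the monomials 1, z^ℓ, w^k, and z^ℓ w^k in Q are all nonzero, i.e., the Newton polygon of the Laurent polynomial P is the rectangle with vertices (0,0), (−ℓ,0), (0,k), (−ℓ,k). -/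
open scoped BigOperators Matrix

universe u

/-- Eliminating all the factors `F i = A i * (B i)⁻¹` from the determinant of
`X + U * (F 0 * F 1 * ⋯) * V`: after multiplication by `∏ det (B i)`, it is the image of a single
ring element that does not depend on the ring homomorphism. -/
theorem exists_map_eq_prod_det_mul_det {R S : Type*} [CommRing R] [CommRing S]
    {κ : Type u} [Fintype κ] [DecidableEq κ] {ℓ : ℕ} (A B : Fin ℓ → Matrix κ κ R)
    {N : Type u} [Fintype N] [DecidableEq N]
    (X : Matrix N N R) (U : Matrix N κ R) (V : Matrix κ N R) :
    ∃ q : R, ∀ (f : R →+* S) (F : Fin ℓ → Matrix κ κ S),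
      (∀ i, F i * (B i).map f = (A i).map f) →
      f q = (∏ i, ((B i).map f).det) *
        (X.map f + U.map f * (List.ofFn F).prod * V.map f).det := by
  induction ℓ generalizing N with
  | zero =>
    refine ⟨(X + U * V).det, fun f F _ => ?_⟩
    rw [RingHom.map_det, RingHom.mapMatrix_apply]
    simp [Matrix.map_add, Matrix.map_mul]
  | succ ℓ ih =>
    obtain ⟨q, hq⟩ := ih (fun i => A i.succ) (fun i => B i.succ)
      (Matrix.fromBlocks (B 0) 0 (U * A 0) X) (Matrix.fromRows (-1) 0) (Matrix.fromCols 0 V)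
    refine ⟨q, fun f F hF => ?_⟩
    rw [hq f (fun i => F i.succ) fun i => hF i.succ, Fin.prod_univ_succ, List.ofFn_succ,
      List.prod_cons]
    set G := (List.ofFn fun i => F i.succ).prod
    have key : (Matrix.fromBlocks (B 0) 0 (U * A 0) X).map f +
        (Matrix.fromRows (-1) 0 : Matrix (κ ⊕ N) κ R).map f * G *
          (Matrix.fromCols 0 V : Matrix κ (κ ⊕ N) R).map f =
        Matrix.fromBlocks 1 0 (U.map f * F 0) 1 *
          Matrix.fromBlocks ((B 0).map f) (-(G * V.map f)) 0
            (X.map f + U.map f * (F 0 * G) * V.map f) := by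
      have h1 : (Matrix.fromRows (-1) 0 : Matrix (κ ⊕ N) κ R).map f = Matrix.fromRows (-1) 0 := by
        ext (i | i) j <;> simp [Matrix.one_apply, apply_ite f]
      have h2 : (Matrix.fromCols 0 V : Matrix κ (κ ⊕ N) R).map f =
          Matrix.fromCols 0 (V.map f) := by
        ext i (j | j) <;> simp
      rw [h1, h2, Matrix.fromBlocks_map, Matrix.fromRows_mul, Matrix.fromRows_mul_fromCols,
        Matrix.fromBlocks_add, Matrix.fromBlocks_multiply]
      simp [Matrix.map_mul, ← hF 0, Matrix.mul_assoc]
    rw [key, Matrix.det_mul, Matrix.det_fromBlocks_zero₁₂, Matrix.det_fromBlocks_zero₂₁]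
    simp only [Matrix.det_one, one_mul]
    ring

/-- The characteristic polynomial of a product of matrices `F i` with `F i * B i (x) = A i (x)`
depends polynomially on the parameter `x` after multiplication by `∏ det (B i (x))`. -/
theorem exists_map_evalRingHom_eq_charpoly {K κ : Type*} [CommRing K] [Fintype κ]
    [DecidableEq κ] {ℓ : ℕ} (A B : Fin ℓ → Matrix κ κ (Polynomial K)) :
    ∃ Q : Polynomial (Polynomial K), ∀ (x : K) (F : Fin ℓ → Matrix κ κ K),
      (∀ i, F i * (B i).map (Polynomial.evalRingHom x) =
        (A i).map (Polynomial.evalRingHom x)) →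
      Q.map (Polynomial.evalRingHom x) =
        Polynomial.C (∏ i, (B i).det.eval x) * (List.ofFn F).prod.charpoly := by
  obtain ⟨q, hq⟩ := exists_map_eq_prod_det_mul_det (S := Polynomial K)
    (fun i => (A i).map (Polynomial.C : Polynomial K →+* _))
    (fun i => (B i).map (Polynomial.C : Polynomial K →+* _))
    (Matrix.scalar κ (Polynomial.X : Polynomial (Polynomial K))) (-1) 1
  refine ⟨q, fun x F hF => ?_⟩
  have h := hq (Polynomial.mapRingHom (Polynomial.evalRingHom x))
    (fun i => (F i).map (Polynomial.C : K →+* _)) (fun i => by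
      have := congrArg (fun M => M.map (Polynomial.C : K →+* _)) (hF i)
      simp only [Matrix.map_mul] at this
      convert this using 2 <;> ext <;> simp)
  rw [Polynomial.coe_mapRingHom] at h
  rw [h]
  congr 1
  · rw [map_prod]
    refine Finset.prod_congr rfl fun i _ => ?_
    rw [← Polynomial.coe_evalRingHom, RingHom.map_det, RingHom.map_det]
    congr 1
    ext
    simp
  · rw [Matrix.charpoly]
    congr 1
    have hl : (List.ofFn fun i => (F i).map (Polynomial.C : K →+* _)).prod =
        (List.ofFn F).prod.map (Polynomial.C : K →+* _) := by
      have := map_list_prod (Polynomial.C : K →+* _).mapMatrix (List.ofFn F)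
      rw [RingHom.mapMatrix_apply] at this
      rw [this, List.map_ofFn]
      rfl
    rw [hl, Matrix.charmatrix]
    ext i j
    simp [Matrix.diagonal_apply, Matrix.map_apply, sub_eq_add_neg, Matrix.map_neg]

/-- The matrix `diag γ + Σ α_i E_{i+1,i} + α_k c E_{1,k}` over a commutative ring. -/
def cyclicBidiagonal {R : Type*} [CommRing R] (k : ℕ) (c : R) (α γ : Fin k → R) :
    Matrix (Fin k) (Fin k) R :=
  Matrix.of fun (i j : Fin k) =>
    (if i = j then γ i else 0) + (if (i : ℕ) = (j : ℕ) + 1 then α j else 0) +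
      (if (i : ℕ) = 0 ∧ (j : ℕ) = k - 1 then α j * c else 0)

theorem phiB_eq_cyclicBidiagonal (k : ℕ) (z : ℂ) (α γ : Fin k → ℂ) :
    phiB k z α γ = cyclicBidiagonal k z⁻¹ α γ := rfl

theorem cyclicBidiagonal_map {R S : Type*} [CommRing R] [CommRing S] (f : R →+* S) (k : ℕ) (c : R)
    (α γ : Fin k → R) :
    (cyclicBidiagonal k c α γ).map f = cyclicBidiagonal k (f c) (f ∘ α) (f ∘ γ) := by
  ext i j
  simp [cyclicBidiagonal, apply_ite f]

theorem det_cyclicBidiagonal {R : Type*} [CommRing R] (n : ℕ) (c : R) (α γ : Fin (n + 1) → R) :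
    (cyclicBidiagonal (n + 1) c α γ).det = ∏ i, γ i + (-1) ^ n * c * ∏ i, α i := by
  have h0 : ((cyclicBidiagonal (n + 1) c α γ).submatrix Fin.succ Fin.succ).det =
      ∏ i : Fin n, γ i.succ := by
    rw [Matrix.det_of_isLowerTriangular]
    · simp [cyclicBidiagonal]
    · intro i j hij
      have : i < j := hij
      rw [Fin.lt_def] at this
      simp only [cyclicBidiagonal, Matrix.submatrix_apply, Matrix.of_apply, Fin.ext_iff,
        Fin.val_succ]
      split_ifs <;> first | omega | rfl | simp_all
  have h1 : ((cyclicBidiagonal (n + 1) c α γ).submatrix Fin.succ Fin.castSucc).det =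
      ∏ i : Fin n, α i.castSucc := by
    rw [Matrix.det_of_isUpperTriangular]
    · refine Finset.prod_congr rfl fun i _ => ?_
      have := i.2
      simp only [cyclicBidiagonal, Matrix.submatrix_apply, Matrix.of_apply, Fin.ext_iff,
        Fin.val_succ, Fin.val_castSucc]
      simp [this.ne]
    · intro i j hij
      have : j < i := hij
      rw [Fin.lt_def] at this
      simp only [cyclicBidiagonal, Matrix.submatrix_apply, Matrix.of_apply, Fin.ext_iff,
        Fin.val_succ, Fin.val_castSucc]
      split_ifs <;> first | omega | rfl | simp_all
  have hrow : ∀ j, cyclicBidiagonal (n + 1) c α γ 0 j =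
      (if j = 0 then γ 0 else 0) + (if j = Fin.last n then α (Fin.last n) * c else 0) := by
    intro j
    have h2 : ¬ ((0 : Fin (n + 1)) : ℕ) = (j : ℕ) + 1 := by simp
    rw [cyclicBidiagonal, Matrix.of_apply, if_neg h2, add_zero]
    simp only [Fin.ext_iff, Fin.val_last, Fin.val_zero, true_and, Nat.add_sub_cancel]
    congr 1
    · by_cases hj : (j : ℕ) = 0
      · simp [hj]
      · simp [hj, Ne.symm hj]
    · by_cases hj : (j : ℕ) = n
      · obtain rfl : j = Fin.last n := Fin.ext hj
        simp
      · simp [hj]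
  rw [Matrix.det_succ_row_zero]
  simp only [hrow, mul_add, add_mul, Finset.sum_add_distrib]
  simp only [mul_ite, ite_mul, mul_zero, zero_mul, Finset.sum_ite_eq', Finset.mem_univ, if_true]
  rw [Fin.prod_univ_succ γ, Fin.prod_univ_castSucc α]
  simp only [Fin.succAbove_zero, Fin.succAbove_last, h0, h1, Fin.val_zero, Fin.val_last]
  ring

/-- `φ^g(z;β)` is the inverse of a bidiagonal matrix of the same shape as `φ^b`. -/
theorem phiG_mul_cyclicBidiagonal (n : ℕ) (z : ℂ) (β : Fin (n + 1) → ℂ) (hz : z ≠ 0)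
    (hzβ : z ≠ ∏ j, β j) :
    phiG (n + 1) z β * cyclicBidiagonal (n + 1) z⁻¹ (-β) 1 = 1 := by
  have hc : 1 - (∏ i, β i) * z⁻¹ ≠ 0 := by
    intro h
    apply hzβ
    field_simp at h
    linear_combination h
  have hprod : ∏ m ∈ Finset.Ico 0 (n + 1), bval β m = ∏ i, β i := by
    rw [← Finset.range_eq_Ico, Finset.prod_range]
    refine Finset.prod_congr rfl fun i _ => ?_
    simp only [bval, i.2, dif_pos]
  have hb : ∀ i : Fin (n + 1), bval β i = β i := fun i => by
    simp only [bval, i.2, dif_pos]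
  rw [phiG, Matrix.smul_mul, inv_smul_eq_iff₀ hc]
  ext i j
  rw [Matrix.mul_apply]
  simp only [Matrix.smul_apply, Matrix.of_apply, smul_eq_mul]
  have hi := i.2
  induction j using Fin.lastCases with
  | last =>
    have hB : ∀ m : Fin (n + 1), cyclicBidiagonal (n + 1) z⁻¹ (-β) 1 m (Fin.last n) =
        (if m = Fin.last n then 1 else 0) + (if m = 0 then -β (Fin.last n) * z⁻¹ else 0) := by
      intro m
      have := m.2
      have h2 : ¬ (m : ℕ) = ((Fin.last n : Fin (n + 1)) : ℕ) + 1 := by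
        rw [Fin.val_last]; omega
      rw [cyclicBidiagonal, Matrix.of_apply, if_neg h2, add_zero]
      simp [Fin.val_eq_zero_iff]
    simp only [hB, mul_add, Finset.sum_add_distrib, mul_ite, mul_one, mul_zero,
      Finset.sum_ite_eq', Finset.mem_univ, if_true, Fin.val_last, Fin.val_zero, zero_le]
    have hbn : bval β n = β (Fin.last n) := hb (Fin.last n)
    rcases eq_or_ne i (Fin.last n) with rfl | h
    · rw [← hprod, Finset.prod_Ico_succ_top (Nat.zero_le n), hbn, Matrix.one_apply_eq]
      simp only [Fin.val_last, le_refl, if_true, Finset.Ico_self, Finset.prod_empty]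
      ring
    · have h' : ¬ n ≤ (i : ℕ) := fun h' => h (Fin.ext (by simp; omega))
      rw [if_neg h', Matrix.one_apply_ne h, Nat.Ico_succ_singleton, Finset.prod_singleton, hbn]
      ring
  | cast j =>
    have hj := j.2
    have hB : ∀ m : Fin (n + 1), cyclicBidiagonal (n + 1) z⁻¹ (-β) 1 m j.castSucc =
        (if m = j.castSucc then 1 else 0) + (if m = j.succ then -β j.castSucc else 0) := by
      intro m
      have h2 : ¬ ((m : ℕ) = 0 ∧ (j.castSucc : ℕ) = n + 1 - 1) := by
        rw [Fin.val_castSucc]; omega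
      rw [cyclicBidiagonal, Matrix.of_apply, if_neg h2, add_zero]
      simp only [Fin.ext_iff, Fin.val_succ, Fin.val_castSucc, Pi.one_apply, Pi.neg_apply]
    simp only [hB, mul_add, Finset.sum_add_distrib, mul_ite, mul_one, mul_zero,
      Finset.sum_ite_eq', Finset.mem_univ, if_true, Fin.val_succ, Fin.val_castSucc]
    have hbj : bval β (j : ℕ) = β j.castSucc := hb j.castSucc
    rcases lt_trichotomy (j : ℕ) i with h | h | h
    · rw [if_pos h.le, if_pos (by omega), Matrix.one_apply_ne (by simp [Fin.ext_iff]; omega),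
        Finset.prod_eq_prod_Ico_succ_bot h, hbj]
      ring
    · obtain rfl : i = j.castSucc := Fin.ext h.symm
      rw [if_pos (by simp), if_neg (by simp), Matrix.one_apply_eq, ← hprod,
        ← Finset.prod_Ico_consecutive (bval β) (Nat.zero_le j) (by omega : (j : ℕ) ≤ n + 1),
        Finset.prod_eq_prod_Ico_succ_bot (by omega : (j : ℕ) < n + 1), hbj]
      simp
      ring
    · rw [if_neg (by omega), if_neg (by omega), Matrix.one_apply_ne (by simp [Fin.ext_iff]; omega),
        Finset.prod_eq_prod_Ico_succ_bot (by omega : (j : ℕ) < n + 1), hbj]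
      ring

/-- Rescaling the last column by `z` clears the pole of `cyclicBidiagonal k z⁻¹ α γ`. -/
theorem cyclicBidiagonal_mul_diagonal (n : ℕ) (z : ℂ) (hz : z ≠ 0) (α γ : Fin (n + 1) → ℂ) :
    cyclicBidiagonal (n + 1) z⁻¹ α γ *
        Matrix.diagonal (fun j => if j = Fin.last n then z else 1) =
      cyclicBidiagonal (n + 1) 1 α (fun j => γ j * if j = Fin.last n then z else 1) := by
  ext i j
  rw [Matrix.mul_diagonal]
  have hi := i.2
  simp only [cyclicBidiagonal, Matrix.of_apply, Fin.ext_iff, Fin.val_last, Nat.add_sub_cancel]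
  split_ifs <;> first | omega | simp [add_mul, hz]

theorem eq_of_eval_eq_off_finite {p q : Polynomial ℂ} {s : Set ℂ} (hs : s.Finite)
    (h : ∀ z ∉ s, p.eval z = q.eval z) : p = q :=
  Polynomial.eq_of_infinite_eval_eq p q (hs.infinite_compl.mono fun z hz => h z hz)

/-- If `p(z) = z ^ n * q(z⁻¹)` for almost all `z`, then `p` has degree at most `n`. -/
theorem natDegree_le_of_eval_eq_pow_mul_eval_inv {p q : Polynomial ℂ} {s : Set ℂ} (hs : s.Finite)
    {n : ℕ} (h : ∀ z ∉ s, p.eval z = z ^ n * q.eval z⁻¹) : p.natDegree ≤ n := by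
  by_cases hp : p = 0
  · simp [hp]
  have key : p * Polynomial.X ^ q.natDegree = Polynomial.X ^ n * q.reverse := by
    refine eq_of_eval_eq_off_finite (hs.union (Set.finite_singleton 0)) fun z hz => ?_
    simp only [Set.mem_union, Set.mem_singleton_iff, not_or] at hz
    let := invertibleOfNonzero (inv_ne_zero hz.2)
    have hr := Polynomial.eval₂_reverse_mul_pow (RingHom.id ℂ) z⁻¹ q
    rw [invOf_eq_inv, inv_inv, Polynomial.eval₂_id, Polynomial.eval₂_id] at hr
    have hz0 := hz.2
    simp only [Polynomial.eval_mul, Polynomial.eval_pow, Polynomial.eval_X]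
    rw [h z hz.1, ← hr, inv_pow]
    field_simp
  have h1 := congrArg Polynomial.natDegree key
  rw [Polynomial.natDegree_mul_X_pow _ hp] at h1
  have h2 := Polynomial.natDegree_mul_le (p := (Polynomial.X : Polynomial ℂ) ^ n) (q := q.reverse)
  have h3 := Polynomial.reverse_natDegree_le q
  rw [Polynomial.natDegree_X_pow] at h2
  omega

theorem phiB_mul_phiG_mul (n : ℕ) {z : ℂ} (α β γ : Fin (n + 1) → ℂ) (hz : z ≠ 0)
    (hzβ : z ≠ ∏ j, β j) :
    phiB (n + 1) z α γ * phiG (n + 1) z β * cyclicBidiagonal (n + 1) z⁻¹ (-β) 1 =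
      cyclicBidiagonal (n + 1) z⁻¹ α γ := by
  rw [Matrix.mul_assoc, phiG_mul_cyclicBidiagonal n z β hz hzβ, Matrix.mul_one,
    phiB_eq_cyclicBidiagonal]

/-- `∏ (z - β_i) · charpoly Φ(z)` is polynomial in `z`. -/
theorem exists_charpoly_cleared (n ℓ : ℕ) (α β γ : Fin (n + 1) → Fin ℓ → ℝ) :
    ∃ Q : Polynomial (Polynomial ℂ), ∀ z : ℂ, z ≠ 0 → (∀ i, z ≠ ∏ j, (β j i : ℂ)) →
      Q.map (Polynomial.evalRingHom z) = Polynomial.C (∏ i, (z - ∏ j, (β j i : ℂ))) *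
        (PhiM (n + 1) ℓ α β γ z).charpoly := by
  obtain ⟨Q, hQ⟩ := exists_map_evalRingHom_eq_charpoly
    (fun i : Fin ℓ => cyclicBidiagonal (n + 1) (1 : Polynomial ℂ)
      (fun j => Polynomial.C (α j i : ℂ))
      (fun j => Polynomial.C (γ j i : ℂ) * if j = Fin.last n then Polynomial.X else 1))
    (fun i : Fin ℓ => cyclicBidiagonal (n + 1) (1 : Polynomial ℂ)
      (fun j => Polynomial.C (-β j i : ℂ)) (fun j => if j = Fin.last n then Polynomial.X else 1))
  refine ⟨Q, fun z hz hzb => ?_⟩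
  rw [PhiM, hQ z]
  · congr 2
    refine Finset.prod_congr rfl fun i _ => ?_
    have hn : (-1 : ℂ) ^ n * (-1) ^ n = 1 := by rw [← mul_pow]; simp
    rw [det_cyclicBidiagonal, Finset.prod_ite_eq', if_pos (Finset.mem_univ _), ← map_prod,
      Finset.prod_neg, Finset.card_univ, Fintype.card_fin]
    simp only [Polynomial.eval_add, Polynomial.eval_mul, Polynomial.eval_pow, Polynomial.eval_neg,
      Polynomial.eval_one, Polynomial.eval_X, Polynomial.eval_C]
    linear_combination (-∏ j, (β j i : ℂ)) * hn
  · intro i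
    have h := congrArg (· * Matrix.diagonal (fun j => if j = Fin.last n then z else 1))
      (phiB_mul_phiG_mul n (fun j => (α j i : ℂ)) (fun j => (β j i : ℂ)) (fun j => (γ j i : ℂ))
        hz (hzb i))
    simp only [Matrix.mul_assoc, cyclicBidiagonal_mul_diagonal n z hz] at h
    rw [cyclicBidiagonal_map, cyclicBidiagonal_map, Matrix.mul_assoc]
    convert h using 4 <;> try funext j
    all_goals simp [apply_ite (Polynomial.eval z)]

/-- `∏ (1 - β_i z⁻¹) · charpoly Φ(z)` is polynomial in `z⁻¹`. -/
theorem exists_charpoly_cleared_inv (n ℓ : ℕ) (α β γ : Fin (n + 1) → Fin ℓ → ℝ) :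
    ∃ Q : Polynomial (Polynomial ℂ), ∀ z : ℂ, z ≠ 0 → (∀ i, z ≠ ∏ j, (β j i : ℂ)) →
      Q.map (Polynomial.evalRingHom z⁻¹) = Polynomial.C (∏ i, (1 - (∏ j, (β j i : ℂ)) * z⁻¹)) *
        (PhiM (n + 1) ℓ α β γ z).charpoly := by
  obtain ⟨Q, hQ⟩ := exists_map_evalRingHom_eq_charpoly
    (fun i : Fin ℓ => cyclicBidiagonal (n + 1) (Polynomial.X : Polynomial ℂ)
      (fun j => Polynomial.C (α j i : ℂ)) (fun j => Polynomial.C (γ j i : ℂ)))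
    (fun i : Fin ℓ => cyclicBidiagonal (n + 1) (Polynomial.X : Polynomial ℂ)
      (fun j => Polynomial.C (-β j i : ℂ)) 1)
  refine ⟨Q, fun z hz hzb => ?_⟩
  rw [PhiM, hQ z⁻¹]
  · congr 2
    refine Finset.prod_congr rfl fun i _ => ?_
    have hn : (-1 : ℂ) ^ n * (-1) ^ n = 1 := by rw [← mul_pow]; simp
    rw [det_cyclicBidiagonal, ← map_prod, Finset.prod_neg, Finset.card_univ, Fintype.card_fin]
    simp only [Polynomial.eval_add, Polynomial.eval_mul, Polynomial.eval_pow, Polynomial.eval_neg,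
      Polynomial.eval_one, Polynomial.eval_X, Polynomial.eval_C, Pi.one_apply,
      Finset.prod_const_one]
    linear_combination (-(∏ j, (β j i : ℂ)) * z⁻¹) * hn
  · intro i
    have h := phiB_mul_phiG_mul n (fun j => (α j i : ℂ)) (fun j => (β j i : ℂ))
      (fun j => (γ j i : ℂ)) hz (hzb i)
    rw [cyclicBidiagonal_map, cyclicBidiagonal_map]
    convert h using 3 <;> try ext
    all_goals simp

theorem det_PhiM (n ℓ : ℕ) (α β γ : Fin (n + 1) → Fin ℓ → ℝ) {z : ℂ} (hz : z ≠ 0)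
    (hzb : ∀ i, z ≠ ∏ j, (β j i : ℂ)) :
    (PhiM (n + 1) ℓ α β γ z).det = ∏ i, ((z - ∏ j, (β j i : ℂ))⁻¹ *
      ((∏ j, (γ j i : ℂ)) * z - (-1) ^ (n + 1) * ∏ j, (α j i : ℂ))) := by
  rw [PhiM, ← Matrix.coe_detMonoidHom, map_list_prod, List.map_ofFn, List.prod_ofFn]
  refine Finset.prod_congr rfl fun i _ => ?_
  have h := congrArg Matrix.det (phiB_mul_phiG_mul n (fun j => (α j i : ℂ))
    (fun j => (β j i : ℂ)) (fun j => (γ j i : ℂ)) hz (hzb i))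
  rw [Matrix.det_mul, det_cyclicBidiagonal, det_cyclicBidiagonal] at h
  have h1 : z - ∏ j, (β j i : ℂ) ≠ 0 := sub_ne_zero.2 (hzb i)
  rw [eq_inv_mul_iff_mul_eq₀ h1]
  have hn : (-1 : ℂ) ^ n * (-1) ^ n = 1 := by rw [← mul_pow]; simp
  simp only [Pi.one_apply, Pi.neg_apply, Finset.prod_const_one, Finset.prod_neg, Finset.card_univ,
    Fintype.card_fin] at h
  simp only [Function.comp_apply, Matrix.coe_detMonoidHom]
  set D := (phiB (n + 1) z (fun j => (α j i : ℂ)) (fun j => (γ j i : ℂ)) *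
    phiG (n + 1) z (fun j => (β j i : ℂ))).det
  linear_combination z * h + (D * (∏ j, (β j i : ℂ)) * ((-1) ^ n * (-1) ^ n) +
    (-1) ^ n * ∏ j, (α j i : ℂ)) * mul_inv_cancel₀ hz + D * (∏ j, (β j i : ℂ)) * hn

/-- There is a genuine polynomial `Q ∈ ℂ[z][w]` with `Q(z,w) = z^ℓ P(z,w)`, of degree `k`
in `w` with leading `w`-coefficient `(−1)^k ∏_i (z − β^v_i)`, of degree `ℓ` in `z`, and
with `Q(z,0) = ∏_i (γ^v_i z − (−1)^k α^v_i)`; in particular the coefficients of `1`, `z^ℓ`,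
`w^k` and `z^ℓ w^k` in `Q` are all nonzero (the Newton polygon of `P` is the full
rectangle). -/
theorem statement18 (k ℓ : ℕ) (hk : 1 ≤ k) (hℓ : 1 ≤ ℓ)
    (α β γ : Fin k → Fin ℓ → ℝ)
    (hα : ∀ j i, 0 < α j i) (hβ : ∀ j i, 0 < β j i) (hγ : ∀ j i, 0 < γ j i) :
    ∃ Q : Polynomial (Polynomial ℂ),
      (∀ z : ℂ, z ≠ 0 → (∀ i : Fin ℓ, z ≠ ∏ j, (β j i : ℂ)) → ∀ w : ℂ,
        (Q.map (Polynomial.evalRingHom z)).eval w = z ^ ℓ * PP k ℓ α β γ z w) ∧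
      Q.natDegree = k ∧
      Q.coeff k = (-1 : Polynomial ℂ) ^ k *
        ∏ i : Fin ℓ, (Polynomial.X - Polynomial.C ((∏ j, β j i : ℝ) : ℂ)) ∧
      (∀ m : ℕ, (Q.coeff m).natDegree ≤ ℓ) ∧
      (∃ m : ℕ, (Q.coeff m).natDegree = ℓ) ∧
      Q.coeff 0 = ∏ i : Fin ℓ,
        (Polynomial.C ((∏ j, γ j i : ℝ) : ℂ) * Polynomial.X -
          (-1 : Polynomial ℂ) ^ k * Polynomial.C ((∏ j, α j i : ℝ) : ℂ)) ∧
      (Q.coeff 0).coeff 0 ≠ 0 ∧ (Q.coeff 0).coeff ℓ ≠ 0 ∧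
      (Q.coeff k).coeff 0 ≠ 0 ∧ (Q.coeff k).coeff ℓ ≠ 0 := by
  obtain ⟨n, rfl⟩ : ∃ n, k = n + 1 := ⟨k - 1, by omega⟩
  set b : Fin ℓ → ℂ := fun i => ∏ j, (β j i : ℂ)
  have hb0 : ∀ i, b i ≠ 0 := fun i =>
    Finset.prod_ne_zero_iff.2 fun j _ => Complex.ofReal_ne_zero.2 (hβ j i).ne'
  set a : Fin ℓ → ℂ := fun i => ∏ j, (α j i : ℂ)
  have ha0 : ∀ i, a i ≠ 0 := fun i =>
    Finset.prod_ne_zero_iff.2 fun j _ => Complex.ofReal_ne_zero.2 (hα j i).ne'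
  set c : Fin ℓ → ℂ := fun i => ∏ j, (γ j i : ℂ)
  have hc0 : ∀ i, c i ≠ 0 := fun i =>
    Finset.prod_ne_zero_iff.2 fun j _ => Complex.ofReal_ne_zero.2 (hγ j i).ne'
  let s : Set ℂ := insert 0 (Set.range b)
  have hs : s.Finite := (Set.finite_range b).insert 0
  have hs0 : ∀ z ∉ s, z ≠ 0 := fun z hz h => hz (Or.inl h)
  have hsb : ∀ z ∉ s, ∀ i, z ≠ b i := fun z hz i h => hz (Or.inr ⟨i, h.symm⟩)
  obtain ⟨Q, hQ⟩ := exists_charpoly_cleared n ℓ α β γ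
  obtain ⟨T, hT⟩ := exists_charpoly_cleared_inv n ℓ α β γ
  have hQc : ∀ m, ∀ z ∉ s, (Q.coeff m).eval z =
      (∏ i, (z - b i)) * (PhiM (n + 1) ℓ α β γ z).charpoly.coeff m := fun m z hz => by
    have := congrArg (fun p => p.coeff m) (hQ z (hs0 z hz) (hsb z hz))
    simpa only [Polynomial.coeff_map, Polynomial.coeff_C_mul, Polynomial.coe_evalRingHom] using this
  have hTc : ∀ m, ∀ z ∉ s, (T.coeff m).eval z⁻¹ =
      (∏ i, (1 - b i * z⁻¹)) * (PhiM (n + 1) ℓ α β γ z).charpoly.coeff m := fun m z hz => by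
    have := congrArg (fun p => p.coeff m) (hT z (hs0 z hz) (hsb z hz))
    simpa only [Polynomial.coeff_map, Polynomial.coeff_C_mul, Polynomial.coe_evalRingHom] using this
  have hprod : ∀ z : ℂ, z ≠ 0 → ∏ i, (z - b i) = z ^ ℓ * ∏ i, (1 - b i * z⁻¹) := fun z hz => by
    rw [← Fin.prod_const, ← Finset.prod_mul_distrib]
    refine Finset.prod_congr rfl fun i _ => ?_
    field_simp
  have hdeg : ∀ m, (Q.coeff m).natDegree ≤ ℓ := fun m =>
    natDegree_le_of_eval_eq_pow_mul_eval_inv hs fun z hz => by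
      rw [hQc m z hz, hTc m z hz, hprod z (hs0 z hz), mul_assoc]
  have hmonic : ∀ z, (PhiM (n + 1) ℓ α β γ z).charpoly.natDegree = n + 1 := fun z => by
    simp [Matrix.charpoly_natDegree_eq_dim]
  have htop : Q.coeff (n + 1) = ∏ i, (Polynomial.X - Polynomial.C (b i)) :=
    eq_of_eval_eq_off_finite hs fun z hz => by
      have h1 := (PhiM (n + 1) ℓ α β γ z).charpoly_monic.coeff_natDegree
      rw [hmonic] at h1
      rw [hQc _ z hz, h1, Polynomial.eval_prod]
      simp
  have hbot : Q.coeff 0 = (-1) ^ (n + 1) * ∏ i, (Polynomial.C (c i) * Polynomial.X -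
      (-1) ^ (n + 1) * Polynomial.C (a i)) :=
    eq_of_eval_eq_off_finite hs fun z hz => by
      have h1 := Matrix.det_eq_sign_charpoly_coeff (PhiM (n + 1) ℓ α β γ z)
      rw [det_PhiM n ℓ α β γ (hs0 z hz) (hsb z hz), Fintype.card_fin] at h1
      have h2 : ((-1 : ℂ) ^ (n + 1)) * (-1) ^ (n + 1) = 1 := by
        rw [← mul_pow]; simp
      have h3 : (PhiM (n + 1) ℓ α β γ z).charpoly.coeff 0 =
          (-1) ^ (n + 1) * ∏ i, ((z - b i)⁻¹ * (c i * z - (-1) ^ (n + 1) * a i)) := by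
        rw [h1, ← mul_assoc, h2, one_mul]
      rw [hQc _ z hz, h3, Polynomial.eval_mul, Polynomial.eval_prod, mul_left_comm,
        ← Finset.prod_mul_distrib]
      simp only [Polynomial.eval_pow, Polynomial.eval_neg, Polynomial.eval_one,
        Polynomial.eval_sub, Polynomial.eval_mul, Polynomial.eval_C, Polynomial.eval_X]
      congr 1
      refine Finset.prod_congr rfl fun i _ => ?_
      rw [mul_inv_cancel_left₀ (sub_ne_zero.2 (hsb z hz i))]
  have hQ0 : ∀ m, n + 1 < m → Q.coeff m = 0 := fun m hm =>
    eq_of_eval_eq_off_finite hs fun z hz => by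
      rw [hQc _ z hz, Polynomial.coeff_eq_zero_of_natDegree_lt (by rwa [hmonic])]
      simp
  have hcoef : ∀ m, (Polynomial.C ((-1) ^ (n + 1)) * Q).coeff m = (-1) ^ (n + 1) * Q.coeff m :=
    fun m => by rw [Polynomial.coeff_C_mul]
  have hsign : ((-1 : Polynomial ℂ) ^ (n + 1)) * (-1) ^ (n + 1) = 1 := by
    rw [← mul_pow]; simp
  have hC : (-1 : Polynomial ℂ) ^ (n + 1) = Polynomial.C ((-1) ^ (n + 1)) := by simp
  have htopℓ : (∏ i, (Polynomial.X - Polynomial.C (b i))).coeff ℓ = 1 := by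
    have := Polynomial.coeff_prod_of_natDegree_le (s := Finset.univ)
      (fun i => Polynomial.X - Polynomial.C (b i)) 1 fun i _ => Polynomial.natDegree_X_sub_C_le _
    simpa using this
  have hbotℓ : (∏ i, (Polynomial.C (c i) * Polynomial.X -
      (-1) ^ (n + 1) * Polynomial.C (a i))).coeff ℓ = ∏ i, c i := by
    have := Polynomial.coeff_prod_of_natDegree_le (s := Finset.univ)
      (fun i => Polynomial.C (c i) * Polynomial.X - (-1) ^ (n + 1) * Polynomial.C (a i)) 1
      fun i _ => by rw [hC, ← Polynomial.C_mul]; compute_degree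
    simpa [hC, ← Polynomial.C_mul, Polynomial.coeff_C, -map_mul, -map_pow] using this
  have htop0 : (Q.coeff (n + 1)).coeff ℓ = 1 := by rw [htop, htopℓ]
  have hneg : ((-1 : ℂ) ^ (n + 1)) ≠ 0 := pow_ne_zero _ (by simp)
  have hlead : ((-1 : Polynomial ℂ) ^ (n + 1) * Q.coeff (n + 1)).coeff ℓ ≠ 0 := by
    rw [hC, Polynomial.coeff_C_mul, htop0, mul_one]
    exact hneg
  push_cast
  refine ⟨Polynomial.C ((-1) ^ (n + 1)) * Q, ?_, ?_, ?_, ?_, ⟨n + 1, ?_⟩, ?_, ?_, ?_, ?_, ?_⟩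
  · intro z hz hzb w
    have h1 : PhiM (n + 1) ℓ α β γ z - w • (1 : Matrix (Fin (n + 1)) (Fin (n + 1)) ℂ) =
        -(Matrix.scalar (Fin (n + 1)) w - PhiM (n + 1) ℓ α β γ z) := by
      rw [neg_sub, Matrix.smul_one_eq_diagonal, Matrix.scalar_apply]
    rw [Polynomial.map_mul, hQ z hz hzb, PP, h1, Matrix.det_neg, Fintype.card_fin,
      Polynomial.eval_mul, Polynomial.eval_mul, Polynomial.eval_C, Matrix.eval_charpoly,
      hprod z hz]
    simp only [b, map_pow, map_neg, map_one, Polynomial.map_pow, Polynomial.map_neg,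
      Polynomial.map_one, Polynomial.eval_pow, Polynomial.eval_neg, Polynomial.eval_one]
    ring
  · refine Polynomial.natDegree_eq_of_le_of_coeff_ne_zero ?_ ?_
    · rw [Polynomial.natDegree_le_iff_coeff_eq_zero]
      intro m hm
      rw [hcoef, hQ0 m hm, mul_zero]
    · intro h
      rw [hcoef] at h
      rw [h] at hlead
      exact hlead (Polynomial.coeff_zero _)
  · rw [hcoef, htop]
  · intro m
    rw [hcoef, hC]
    exact (Polynomial.natDegree_C_mul_le _ _).trans (hdeg m)
  · rw [hcoef]
    refine Polynomial.natDegree_eq_of_le_of_coeff_ne_zero ?_ hlead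
    rw [hC]
    exact (Polynomial.natDegree_C_mul_le _ _).trans (hdeg _)
  · rw [hcoef, hbot, ← mul_assoc, hsign, one_mul]
  · rw [hcoef, hbot, ← mul_assoc, hsign, one_mul, Polynomial.coeff_zero_prod]
    refine Finset.prod_ne_zero_iff.2 fun i _ => ?_
    simpa [hC, ← Polynomial.C_mul, -map_mul, -map_pow] using ha0 i
  · rw [hcoef, hbot, ← mul_assoc, hsign, one_mul, hbotℓ]
    exact Finset.prod_ne_zero_iff.2 fun i _ => hc0 i
  · rw [hcoef, htop, hC, Polynomial.coeff_C_mul, Polynomial.coeff_zero_prod]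
    refine mul_ne_zero hneg (Finset.prod_ne_zero_iff.2 fun i _ => ?_)
    simpa using hb0 i
  · rw [hcoef]
    exact hlead
end
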